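/- arXiv:2604.03842 — 11 statements merged into one kernel-verified Lean document; each statement's English description precedes it below -/
import Mathlib

section
/- Let n > 13 be odd with 3 ∤ n. Then there exists a ∈ (ZMod n)^3 such that a·u ≠ 0 for every u ∈ U, i.e. μ(a) = 0. -/
open scoped Classical

abbrev Z3 (n : ℕ) := ZMod n × ZMod n × ZMod n

def queenU (n : ℕ) : Finset (Z3 n) :=
  {(1,0,0), (0,1,0), (0,0,1), (1,1,0), (1,-1,0), (1,0,1), (1,0,-1),
   (0,1,1), (0,1,-1), (1,1,1), (1,1,-1), (1,-1,1), (1,-1,-1)}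

def qdot {n : ℕ} (a u : Z3 n) : ZMod n :=
  a.1 * u.1 + a.2.1 * u.2.1 + a.2.2 * u.2.2

def qmu (n : ℕ) (a : Z3 n) : ℕ :=
  ((queenU n).filter (fun u => qdot a u = 0)).card

theorem natCast_ne_zero_of_small (n k : ℕ) (hn : 13 < n) (h0 : 0 < k) (hk : k < 8) :
    (k : ZMod n) ≠ 0 := by
  intro h
  rw [ZMod.natCast_eq_zero_iff] at h
  have := Nat.le_of_dvd h0 h
  omega

/-- For `n > 13` odd with `3 ∤ n`, there is a frequency `a` orthogonal to no
queen direction: `μ(a) = 0`. -/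
theorem stmt5 (n : ℕ) (hn : 13 < n) (hodd : Odd n) (h3 : ¬ (3 ∣ n)) :
    ∃ a : Z3 n, (∀ u ∈ queenU n, qdot a u ≠ 0) ∧ qmu n a = 0 := by
  have h : ∀ u ∈ queenU n, qdot ((1, 2, 4) : Z3 n) u ≠ 0 := by
    have c := fun k => natCast_ne_zero_of_small n k hn
    have c1 := c 1 (by norm_num) (by norm_num)
    have c2 := c 2 (by norm_num) (by norm_num)
    have c3 := c 3 (by norm_num) (by norm_num)
    have c4 := c 4 (by norm_num) (by norm_num)
    have c5 := c 5 (by norm_num) (by norm_num)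
    have c6 := c 6 (by norm_num) (by norm_num)
    have c7 := c 7 (by norm_num) (by norm_num)
    push_cast at c1 c2 c3 c4 c5 c6 c7
    intro u hu
    simp only [queenU, Finset.mem_insert, Finset.mem_singleton] at hu
    rcases hu with rfl | rfl | rfl | rfl | rfl | rfl | rfl | rfl | rfl | rfl | rfl | rfl | rfl <;>
      simp only [qdot] <;> intro h <;>
      first
      | exact c1 (by linear_combination h)
      | exact c1 (by linear_combination -h)
      | exact c2 (by linear_combination h)
      | exact c2 (by linear_combination -h)
      | exact c3 (by linear_combination h)
      | exact c3 (by linear_combination -h)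
      | exact c4 (by linear_combination h)
      | exact c5 (by linear_combination h)
      | exact c5 (by linear_combination -h)
      | exact c6 (by linear_combination h)
      | exact c7 (by linear_combination h)
  refine ⟨(1, 2, 4), h, ?_⟩
  rw [qmu, Finset.card_eq_zero, Finset.filter_eq_empty_iff]
  exact fun {u} hu => h u hu
end

section
/- Let n ≥ 5 be odd with 3 ∤ n. If a ∈ (ZMod n)^3 is nonzero and μ(a) ≥ 2, then a is a ZMod n-multiple of one of the following 25 vectors: the 3 axis generators (1,0,0), (0,1,0), (0,0,1); the 6 face-diagonal generators (1,1,0), (1,−1,0), (1,0,1), (1,0,−1), (0,1,1), (0,1,−1); the 4 space-diagonal generators (1,1,1), (1,1,−1), (1,−1,1), (1,−1,−1); and the 12 skew generators obtained from (1,1,2) by all coordinate permutations and independent sign changes up to global sign, namely (1,1,2), (1,1,−2), (1,−1,2), (1,−1,−2), (1,2,1), (1,2,−1), (1,−2,1), (1,−2,−1), (2,1,1), (2,1,−1), (2,−1,1), (2,−1,−1). -/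
open scoped Classical

/-- Coordinate form of "`(x,y,z)` is a multiple of one of the 25 generators". -/
def IsProto {R : Type*} [CommRing R] (x y z : R) : Prop :=
  (y = 0 ∧ z = 0) ∨
  (x = 0 ∧ z = 0) ∨
  (x = 0 ∧ y = 0) ∨
  (y = x ∧ z = 0) ∨
  (y = -x ∧ z = 0) ∨
  (y = 0 ∧ z = x) ∨
  (y = 0 ∧ z = -x) ∨
  (x = 0 ∧ z = y) ∨
  (x = 0 ∧ z = -y) ∨
  (y = x ∧ z = x) ∨
  (y = x ∧ z = -x) ∨
  (y = -x ∧ z = x) ∨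
  (y = -x ∧ z = -x) ∨
  (y = x ∧ z = 2 * x) ∨
  (y = x ∧ z = -(2 * x)) ∨
  (y = -x ∧ z = 2 * x) ∨
  (y = -x ∧ z = -(2 * x)) ∨
  (y = 2 * x ∧ z = x) ∨
  (y = 2 * x ∧ z = -x) ∨
  (y = -(2 * x) ∧ z = x) ∨
  (y = -(2 * x) ∧ z = -x) ∨
  (x = 2 * y ∧ z = y) ∨
  (x = 2 * y ∧ z = -y) ∨
  (x = -(2 * y) ∧ z = -y) ∨
  (x = -(2 * y) ∧ z = y)

/-- Vanishing of one of the 13 linear forms. -/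
def IsForm {R : Type*} [CommRing R] (i : Fin 13) (x y z : R) : Prop :=
  match i with
  | 0 => x = 0
  | 1 => y = 0
  | 2 => z = 0
  | 3 => x + y = 0
  | 4 => x - y = 0
  | 5 => x + z = 0
  | 6 => x - z = 0
  | 7 => y + z = 0
  | 8 => y - z = 0
  | 9 => x + y + z = 0
  | 10 => x + y - z = 0
  | 11 => x - y + z = 0
  | 12 => x - y - z = 0

theorem isProto_of {R : Type*} [CommRing R] (r x y z : R) (hr : 2 * r = 1) (i j : Fin 13)
    (hij : i < j) (hi : IsForm i x y z) (hj : IsForm j x y z) : IsProto x y z := by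
  have h2 : ∀ t : R, 2 * t = 0 → t = 0 := fun t ht => by linear_combination r * ht - t * hr
  unfold IsProto
  fin_cases i <;> fin_cases j <;>
    first
    | exact absurd hij (by decide)
    | (clear hij
       simp only [IsForm] at hi hj
       have hx := h2 x
       have hy := h2 y
       have hz := h2 z
       clear h2
       grind)

/-- Enumeration of the 13 vectors. -/
def formVec (n : ℕ) (i : Fin 13) : Z3 n :=
  match i with
  | 0 => (1,0,0)
  | 1 => (0,1,0)
  | 2 => (0,0,1)
  | 3 => (1,1,0)
  | 4 => (1,-1,0)
  | 5 => (1,0,1)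
  | 6 => (1,0,-1)
  | 7 => (0,1,1)
  | 8 => (0,1,-1)
  | 9 => (1,1,1)
  | 10 => (1,1,-1)
  | 11 => (1,-1,1)
  | 12 => (1,-1,-1)

theorem exists_form (n : ℕ) (a u : Z3 n) (hu : u ∈ queenU n) (h : qdot a u = 0) :
    ∃ i, u = formVec n i ∧ IsForm i a.1 a.2.1 a.2.2 := by
  simp only [queenU, Finset.mem_insert, Finset.mem_singleton] at hu
  rcases hu with rfl | rfl | rfl | rfl | rfl | rfl | rfl | rfl | rfl | rfl | rfl | rfl | rfl
  · exact ⟨0, rfl, by simp only [qdot] at h; simp only [IsForm]; linear_combination h⟩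
  · exact ⟨1, rfl, by simp only [qdot] at h; simp only [IsForm]; linear_combination h⟩
  · exact ⟨2, rfl, by simp only [qdot] at h; simp only [IsForm]; linear_combination h⟩
  · exact ⟨3, rfl, by simp only [qdot] at h; simp only [IsForm]; linear_combination h⟩
  · exact ⟨4, rfl, by simp only [qdot] at h; simp only [IsForm]; linear_combination h⟩
  · exact ⟨5, rfl, by simp only [qdot] at h; simp only [IsForm]; linear_combination h⟩
  · exact ⟨6, rfl, by simp only [qdot] at h; simp only [IsForm]; linear_combination h⟩
  · exact ⟨7, rfl, by simp only [qdot] at h; simp only [IsForm]; linear_combination h⟩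
  · exact ⟨8, rfl, by simp only [qdot] at h; simp only [IsForm]; linear_combination h⟩
  · exact ⟨9, rfl, by simp only [qdot] at h; simp only [IsForm]; linear_combination h⟩
  · exact ⟨10, rfl, by simp only [qdot] at h; simp only [IsForm]; linear_combination h⟩
  · exact ⟨11, rfl, by simp only [qdot] at h; simp only [IsForm]; linear_combination h⟩
  · exact ⟨12, rfl, by simp only [qdot] at h; simp only [IsForm]; linear_combination h⟩

set_option linter.unusedSimpArgs false
set_option maxHeartbeats 4000000 in
/-- Prototype lines: every nonzero `a` with `μ(a) ≥ 2` is a `ZMod n`-multiple of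
one of 25 explicit generators (3 axis, 6 face-diagonal, 4 space-diagonal,
12 skew). -/
theorem stmt9 (n : ℕ) (hn : 5 ≤ n) (hodd : Odd n) (h3 : ¬ (3 ∣ n))
    (a : Z3 n) (ha : a ≠ 0) (hmu : 2 ≤ qmu n a) :
    ∃ v ∈ ({(1,0,0), (0,1,0), (0,0,1),
            (1,1,0), (1,-1,0), (1,0,1), (1,0,-1), (0,1,1), (0,1,-1),
            (1,1,1), (1,1,-1), (1,-1,1), (1,-1,-1),
            (1,1,2), (1,1,-2), (1,-1,2), (1,-1,-2),
            (1,2,1), (1,2,-1), (1,-2,1), (1,-2,-1),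
            (2,1,1), (2,1,-1), (2,-1,1), (2,-1,-1)} : Finset (Z3 n)),
      ∃ c : ZMod n, a = c • v := by
  have : Fact (1 < n) := ⟨by omega⟩
  obtain ⟨r, hr⟩ : ∃ r : ZMod n, 2 * r = 1 := by
    have hc : Nat.Coprime 2 n := (Nat.coprime_two_left).2 hodd
    exact ⟨((2 : ℕ) : ZMod n)⁻¹, by simpa using ZMod.coe_mul_inv_eq_one 2 hc⟩
  obtain ⟨u, hu, w, hw, huw⟩ := Finset.one_lt_card.1 (show 1 < _ from hmu)
  rw [Finset.mem_filter] at hu hw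
  obtain ⟨i, rfl, hi⟩ := exists_form n a u hu.1 hu.2
  obtain ⟨j, rfl, hj⟩ := exists_form n a w hw.1 hw.2
  have hp : IsProto a.1 a.2.1 a.2.2 := by
    rcases lt_trichotomy i j with h | h | h
    · exact isProto_of r _ _ _ hr i j h hi hj
    · exact absurd (by rw [h]) huw
    · exact isProto_of r _ _ _ hr j i h hj hi
  obtain ⟨x, y, z⟩ := a
  clear hi hj hu hw huw hmu ha
  simp only [IsProto] at hp
  rcases hp with ⟨h, hb⟩ | ⟨h, hb⟩ | ⟨h, hb⟩ | ⟨h, hb⟩ | ⟨h, hb⟩ | ⟨h, hb⟩ | ⟨h, hb⟩ | ⟨h, hb⟩ | ⟨h, hb⟩ | ⟨h, hb⟩ | ⟨h, hb⟩ | ⟨h, hb⟩ | ⟨h, hb⟩ | ⟨h, hb⟩ | ⟨h, hb⟩ | ⟨h, hb⟩ | ⟨h, hb⟩ | ⟨h, hb⟩ | ⟨h, hb⟩ | ⟨h, hb⟩ | ⟨h, hb⟩ | ⟨h, hb⟩ | ⟨h, hb⟩ | ⟨h, hb⟩ | ⟨h, hb⟩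
  · exact ⟨(1,0,0), by simp, x, by ext <;> simp [h, hb, mul_comm]⟩
  · exact ⟨(0,1,0), by simp, y, by ext <;> simp [h, hb, mul_comm]⟩
  · exact ⟨(0,0,1), by simp, z, by ext <;> simp [h, hb, mul_comm]⟩
  · exact ⟨(1,1,0), by simp, x, by ext <;> simp [h, hb, mul_comm]⟩
  · exact ⟨(1,-1,0), by simp, x, by ext <;> simp [h, hb, mul_comm]⟩
  · exact ⟨(1,0,1), by simp, x, by ext <;> simp [h, hb, mul_comm]⟩
  · exact ⟨(1,0,-1), by simp, x, by ext <;> simp [h, hb, mul_comm]⟩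
  · exact ⟨(0,1,1), by simp, y, by ext <;> simp [h, hb, mul_comm]⟩
  · exact ⟨(0,1,-1), by simp, y, by ext <;> simp [h, hb, mul_comm]⟩
  · exact ⟨(1,1,1), by simp, x, by ext <;> simp [h, hb, mul_comm]⟩
  · exact ⟨(1,1,-1), by simp, x, by ext <;> simp [h, hb, mul_comm]⟩
  · exact ⟨(1,-1,1), by simp, x, by ext <;> simp [h, hb, mul_comm]⟩
  · exact ⟨(1,-1,-1), by simp, x, by ext <;> simp [h, hb, mul_comm]⟩
  · exact ⟨(1,1,2), by simp, x, by ext <;> simp [h, hb, mul_comm]⟩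
  · exact ⟨(1,1,-2), by simp, x, by ext <;> simp [h, hb, mul_comm]⟩
  · exact ⟨(1,-1,2), by simp, x, by ext <;> simp [h, hb, mul_comm]⟩
  · exact ⟨(1,-1,-2), by simp, x, by ext <;> simp [h, hb, mul_comm]⟩
  · exact ⟨(1,2,1), by simp, x, by ext <;> simp [h, hb, mul_comm]⟩
  · exact ⟨(1,2,-1), by simp, x, by ext <;> simp [h, hb, mul_comm]⟩
  · exact ⟨(1,-2,1), by simp, x, by ext <;> simp [h, hb, mul_comm]⟩
  · exact ⟨(1,-2,-1), by simp, x, by ext <;> simp [h, hb, mul_comm]⟩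
  · exact ⟨(2,1,1), by simp, y, by ext <;> simp [h, hb, mul_comm]⟩
  · exact ⟨(2,1,-1), by simp, y, by ext <;> simp [h, hb, mul_comm]⟩
  · exact ⟨(2,-1,1), by simp, -y, by ext <;> simp [h, hb, mul_comm]⟩
  · exact ⟨(2,-1,-1), by simp, -y, by ext <;> simp [h, hb, mul_comm]⟩
end

section
/- Let n ≥ 5 be odd with 3 ∤ n. The 25 cyclic submodules of (ZMod n)^3 generated respectively by the 3 axis vectors (1,0,0),(0,1,0),(0,0,1), the 6 face-diagonal vectors (1,1,0),(1,−1,0),(1,0,1),(1,0,−1),(0,1,1),(0,1,−1), the 4 space-diagonal vectors (1,1,1),(1,1,−1),(1,−1,1),(1,−1,−1), and the 12 skew vectors (1,1,2),(1,1,−2),(1,−1,2),(1,−1,−2),(1,2,1),(1,2,−1),(1,−2,1),(1,−2,−1),(2,1,1),(2,1,−1),(2,−1,1),(2,−1,−1), are pairwise distinct, each contains exactly n points, and any two of them intersect only in the zero vector. -/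
open scoped Classical

def castZ3 (n : ℕ) (v : ℤ × ℤ × ℤ) : Z3 n := ((v.1 : ZMod n), (v.2.1 : ZMod n), (v.2.2 : ZMod n))

def listZ : List (ℤ × ℤ × ℤ) :=
  [(1,0,0), (0,1,0), (0,0,1),
   (1,1,0), (1,-1,0), (1,0,1), (1,0,-1), (0,1,1), (0,1,-1),
   (1,1,1), (1,1,-1), (1,-1,1), (1,-1,-1),
   (1,1,2), (1,1,-2), (1,-1,2), (1,-1,-2),
   (1,2,1), (1,2,-1), (1,-2,1), (1,-2,-1),
   (2,1,1), (2,1,-1), (2,-1,1), (2,-1,-1)]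

/-- gcd of the coordinates -/
def gcd3 (a b c : ℤ) : ℕ := Int.gcd (Int.gcd a b) c

/-- the gcd of the coordinates of the cross product divides 36 -/
def GoodPair (v w : ℤ × ℤ × ℤ) : Prop :=
  gcd3 (v.2.1 * w.2.2 - v.2.2 * w.2.1) (v.2.2 * w.1 - v.1 * w.2.2)
    (v.1 * w.2.1 - v.2.1 * w.1) ∣ 36

instance (v w : ℤ × ℤ × ℤ) : Decidable (GoodPair v w) := by
  unfold GoodPair; infer_instance

set_option maxRecDepth 100000 in
theorem listZ_good : listZ.Pairwise GoodPair := by decide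

theorem listZ_prim : ∀ v ∈ listZ, gcd3 v.1 v.2.1 v.2.2 = 1 := by decide

theorem mul_gcd_zero {n : ℕ} (c : ZMod n) (a b : ℤ) (ha : c * (a : ZMod n) = 0)
    (hb : c * (b : ZMod n) = 0) : c * (((Int.gcd a b : ℕ) : ℤ) : ZMod n) = 0 := by
  rw [Int.gcd_eq_gcd_ab]
  push_cast
  linear_combination (Int.gcdA a b : ZMod n) * ha + (Int.gcdB a b : ZMod n) * hb

theorem mul_gcd3_zero {n : ℕ} (c : ZMod n) (x y z : ℤ) (hx : c * (x : ZMod n) = 0)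
    (hy : c * (y : ZMod n) = 0) (hz : c * (z : ZMod n) = 0) :
    c * ((gcd3 x y z : ℕ) : ZMod n) = 0 := by
  have := mul_gcd_zero c _ z (mul_gcd_zero c x y hx hy) hz
  simpa [gcd3] using this

theorem smul_castZ3_eq_zero {n : ℕ} {v : ℤ × ℤ × ℤ} (hv : gcd3 v.1 v.2.1 v.2.2 = 1)
    {c : ZMod n} (h : c • castZ3 n v = 0) : c = 0 := by
  simp only [castZ3, Prod.smul_mk, smul_eq_mul, Prod.mk_eq_zero] at h
  have := mul_gcd3_zero c _ _ _ h.1 h.2.1 h.2.2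
  simpa [hv] using this

theorem smul_good {n : ℕ} (hu : IsUnit (36 : ZMod n)) {v w : ℤ × ℤ × ℤ} (hvw : GoodPair v w)
    {c d : ZMod n} (h : c • castZ3 n v = d • castZ3 n w) : c = 0 := by
  simp only [castZ3, Prod.smul_mk, smul_eq_mul, Prod.mk.injEq] at h
  obtain ⟨h1, h2, h3⟩ := h
  have key := mul_gcd3_zero c (v.2.1 * w.2.2 - v.2.2 * w.2.1) (v.2.2 * w.1 - v.1 * w.2.2)
    (v.1 * w.2.1 - v.2.1 * w.1)
    (by push_cast; linear_combination (w.2.2 : ZMod n) * h2 - (w.2.1 : ZMod n) * h3)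
    (by push_cast; linear_combination (w.1 : ZMod n) * h3 - (w.2.2 : ZMod n) * h1)
    (by push_cast; linear_combination (w.2.1 : ZMod n) * h1 - (w.1 : ZMod n) * h2)
  obtain ⟨k, hk⟩ := hvw
  have h36 : c * (36 : ZMod n) = 0 := by
    have : (36 : ZMod n) = ((36 : ℕ) : ZMod n) := by norm_num
    rw [this, hk]
    push_cast
    rw [← mul_assoc, key, zero_mul]
  exact (hu.mul_left_eq_zero).1 h36

theorem inter_good {n : ℕ} (hu : IsUnit (36 : ZMod n)) {v w : ℤ × ℤ × ℤ} (hvw : GoodPair v w) :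
    {x : Z3 n | ∃ c : ZMod n, x = c • castZ3 n v} ∩
      {x : Z3 n | ∃ c : ZMod n, x = c • castZ3 n w} = {0} := by
  ext x
  constructor
  · rintro ⟨⟨c, rfl⟩, d, hd⟩
    rw [smul_good hu hvw hd, zero_smul]; rfl
  · rintro rfl
    exact ⟨⟨0, (zero_smul _ _).symm⟩, 0, (zero_smul _ _).symm⟩

/-- The 25 cyclic submodules generated by the axis, face-diagonal,
space-diagonal and skew vectors are pairwise distinct, each has exactly `n`
points, and any two of them meet only in `0`. -/
theorem stmt10 (n : ℕ) (hn : 5 ≤ n) (hodd : Odd n) (h3 : ¬ (3 ∣ n)) :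
    let L : List (Z3 n) :=
      [(1,0,0), (0,1,0), (0,0,1),
       (1,1,0), (1,-1,0), (1,0,1), (1,0,-1), (0,1,1), (0,1,-1),
       (1,1,1), (1,1,-1), (1,-1,1), (1,-1,-1),
       (1,1,2), (1,1,-2), (1,-1,2), (1,-1,-2),
       (1,2,1), (1,2,-1), (1,-2,1), (1,-2,-1),
       (2,1,1), (2,1,-1), (2,-1,1), (2,-1,-1)]
    List.Pairwise (fun v w =>
        {x : Z3 n | ∃ c : ZMod n, x = c • v} ≠ {x : Z3 n | ∃ c : ZMod n, x = c • w}) L ∧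
    (∀ v ∈ L, {x : Z3 n | ∃ c : ZMod n, x = c • v}.ncard = n) ∧
    List.Pairwise (fun v w =>
        {x : Z3 n | ∃ c : ZMod n, x = c • v} ∩ {x : Z3 n | ∃ c : ZMod n, x = c • w}
          = {0}) L := by
  intro L
  have hL : L = listZ.map (castZ3 n) := by
    simp [L, listZ, castZ3]
  have hu : IsUnit (36 : ZMod n) := by
    have h2 : Nat.Coprime 2 n := hodd.coprime_two_left
    have h3' : Nat.Coprime 3 n := (Nat.Prime.coprime_iff_not_dvd Nat.prime_three).2 h3
    have h36 : Nat.Coprime 36 n := by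
      have := Nat.Coprime.mul_left (h2.pow_left 2) (h3'.pow_left 2)
      simpa using this
    have := (ZMod.isUnit_iff_coprime 36 n).2 h36
    simpa using this
  have : Fact (1 < n) := ⟨by omega⟩
  have : NeZero n := ⟨by omega⟩
  rw [hL]
  refine ⟨?_, ?_, ?_⟩
  · rw [List.pairwise_map]
    refine listZ_good.imp_of_mem ?_
    intro v w hv _ hvw heq
    have hi := inter_good hu hvw
    rw [← heq, Set.inter_self] at hi
    have hm : castZ3 n v ∈ {x : Z3 n | ∃ c : ZMod n, x = c • castZ3 n v} :=
      ⟨1, (one_smul _ _).symm⟩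
    rw [hi] at hm
    have h0 : (1 : ZMod n) • castZ3 n v = 0 := by rw [one_smul]; exact hm
    exact one_ne_zero (smul_castZ3_eq_zero (listZ_prim v hv) h0)
  · intro v hv
    obtain ⟨u, hu', rfl⟩ := List.mem_map.1 hv
    have hr : {x : Z3 n | ∃ c : ZMod n, x = c • castZ3 n u} =
        (fun c : ZMod n => c • castZ3 n u) '' Set.univ := by
      ext x
      simp [eq_comm]
    rw [hr, Set.ncard_image_of_injective, Set.ncard_univ, Nat.card_zmod]
    intro c d hcd
    have : (c - d) • castZ3 n u = 0 := by
      rw [sub_smul]; exact sub_eq_zero.2 hcd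
    exact sub_eq_zero.1 (smul_castZ3_eq_zero (listZ_prim u hu') this)
  · rw [List.pairwise_map]
    exact listZ_good.imp fun h => inter_good hu h
end

section
/- Let n ≥ 5 be odd with 3 ∤ n. For every a ∈ (ZMod n)^3, the orthogonality count μ(a) belongs to {0, 1, 2, 3, 4, 13}. -/
open scoped Classical

theorem qaux {n : ℕ} (i x y z : ZMod n) (hi : 6 * i = 1)
    (h0 : ¬ (x = 0 ∧ y = 0 ∧ z = 0)) :
    (if x = 0 then 1 else 0) + ((if y = 0 then 1 else 0) + ((if z = 0 then 1 else 0) +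
    ((if x + y = 0 then 1 else 0) + ((if x - y = 0 then 1 else 0) +
    ((if x + z = 0 then 1 else 0) + ((if x - z = 0 then 1 else 0) +
    ((if y + z = 0 then 1 else 0) + ((if y - z = 0 then 1 else 0) +
    ((if x + y + z = 0 then 1 else 0) + ((if x + y - z = 0 then 1 else 0) +
    ((if x - y + z = 0 then 1 else 0) + (if x - y - z = 0 then 1 else 0)))))))))))) ≤ 4 := by
  have h2 : ∀ t : ZMod n, 2 * t = 0 → t = 0 := fun t ht => by
    linear_combination (3 * i) * ht - t * hi
  have h3 : ∀ t : ZMod n, 3 * t = 0 → t = 0 := fun t ht => by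
    linear_combination (2 * i) * ht - t * hi
  have h4 : ∀ t : ZMod n, 4 * t = 0 → t = 0 := fun t ht => by
    apply h2; apply h2; linear_combination ht
  have x2 := h2 x
  have y2 := h2 y
  have z2 := h2 z
  have x3 := h3 x
  have y3 := h3 y
  have z3 := h3 z
  have x4 := h4 x
  have y4 := h4 y
  have z4 := h4 z
  clear h2 h3 h4 hi
  grind (splits := 40)

/-- The orthogonality count only takes the values `0, 1, 2, 3, 4, 13`. -/
theorem stmt11 (n : ℕ) (hn : 5 ≤ n) (hodd : Odd n) (h3 : ¬ (3 ∣ n))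
    (a : Z3 n) :
    qmu n a ∈ ({0, 1, 2, 3, 4, 13} : Finset ℕ) := by
  obtain ⟨x, y, z⟩ := a
  have h6 : Nat.Coprime 6 n := by
    have h2 : Nat.Coprime 2 n := hodd.coprime_two_left
    have h3' : Nat.Coprime 3 n := (Nat.Prime.coprime_iff_not_dvd Nat.prime_three).2 h3
    exact Nat.Coprime.mul_left h2 h3'
  obtain ⟨i, hi⟩ : ∃ i : ZMod n, 6 * i = 1 :=
    ⟨((6 : ℕ) : ZMod n)⁻¹, by exact_mod_cast ZMod.coe_mul_inv_eq_one 6 h6⟩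
  have : Fact (1 < n) := ⟨by omega⟩
  have h10 : (1 : ZMod n) ≠ 0 := one_ne_zero
  have h11 : (1 : ZMod n) ≠ -1 := by grind
  have h11' : (-1 : ZMod n) ≠ 1 := h11.symm
  have key : qmu n (x, y, z) =
    (if x = 0 then 1 else 0) + ((if y = 0 then 1 else 0) + ((if z = 0 then 1 else 0) +
    ((if x + y = 0 then 1 else 0) + ((if x - y = 0 then 1 else 0) +
    ((if x + z = 0 then 1 else 0) + ((if x - z = 0 then 1 else 0) +
    ((if y + z = 0 then 1 else 0) + ((if y - z = 0 then 1 else 0) +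
    ((if x + y + z = 0 then 1 else 0) + ((if x + y - z = 0 then 1 else 0) +
    ((if x - y + z = 0 then 1 else 0) + (if x - y - z = 0 then 1 else 0)))))))))))) := by
    unfold qmu queenU
    rw [Finset.card_filter]
    repeat rw [Finset.sum_insert (by simp [h11, h11'])]
    rw [Finset.sum_singleton]
    simp [qdot, sub_eq_add_neg]
  by_cases h0 : x = 0 ∧ y = 0 ∧ z = 0
  · obtain ⟨rfl, rfl, rfl⟩ := h0
    rw [key]
    simp
  · have h4 := qaux i x y z hi h0
    rw [← key] at h4
    generalize qmu n (x, y, z) = m at h4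
    interval_cases m <;> simp
end

section
/- Let n ≥ 5 be odd with 3 ∤ n. Then {a ∈ (ZMod n)^3 : μ(a) = 13} = {0}; in particular the number of a with μ(a) = 13 is exactly 1. -/
open scoped Classical

theorem queenU_card (n : ℕ) (hn : 5 ≤ n) : (queenU n).card = 13 := by
  have h1 : (1 : ZMod n) ≠ 0 := by
    intro h
    have := (ZMod.natCast_eq_zero_iff 1 n).1 (by exact_mod_cast h)
    have := Nat.le_of_dvd (by norm_num) this
    omega
  have h2 : (1 : ZMod n) ≠ -1 := by
    intro h
    have h' : ((2 : ℕ) : ZMod n) = 0 := by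
      push_cast
      linear_combination h
    have := (ZMod.natCast_eq_zero_iff 2 n).1 h'
    have := Nat.le_of_dvd (by norm_num) this
    omega
  have h3 : (-1 : ZMod n) ≠ 0 := neg_ne_zero.2 h1
  unfold queenU
  repeat rw [Finset.card_insert_of_notMem (by
    simp only [Finset.mem_insert, Finset.mem_singleton, Prod.mk.injEq, h1, h2, h3, h1.symm,
      h2.symm, h3.symm, and_false, false_and, and_true, true_and, or_false, not_false_eq_true])]
  rw [Finset.card_singleton]

/-- The only frequency with `μ(a) = 13` is `a = 0`; in particular the count of
such frequencies is exactly `1`. -/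
theorem stmt12 (n : ℕ) (hn : 5 ≤ n) (hodd : Odd n) (h3 : ¬ (3 ∣ n)) :
    {a : Z3 n | qmu n a = 13} = {0} ∧ {a : Z3 n | qmu n a = 13}.ncard = 1 := by
  have key : {a : Z3 n | qmu n a = 13} = {0} := by
    ext a
    simp only [Set.mem_setOf_eq, Set.mem_singleton_iff]
    constructor
    · intro h
      unfold qmu at h
      rw [← queenU_card n hn, Finset.card_filter_eq_iff] at h
      have e1 := h (1, 0, 0) (by simp [queenU])
      have e2 := h (0, 1, 0) (by simp [queenU])
      have e3 := h (0, 0, 1) (by simp [queenU])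
      simp only [qdot, mul_one, mul_zero, add_zero, zero_add] at e1 e2 e3
      exact Prod.ext e1 (Prod.ext e2 e3)
    · rintro rfl
      unfold qmu
      rw [← queenU_card n hn, Finset.card_filter_eq_iff]
      intro u _
      simp [qdot]
  exact ⟨key, by rw [key, Set.ncard_singleton]⟩
end

section
/- Let n ≥ 5 be odd with 3 ∤ n. The number of a ∈ (ZMod n)^3 with μ(a) = 4 is exactly 9(n − 1). -/
open scoped Classical

lemma qmu_eq (n : ℕ) (h10 : (1 : ZMod n) ≠ 0) (h11 : (1 : ZMod n) ≠ -1) (x y z : ZMod n) :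
    qmu n (x, y, z) =
      (if x = 0 then 1 else 0) + (if y = 0 then 1 else 0) + (if z = 0 then 1 else 0)
      + (if x + y = 0 then 1 else 0) + (if x - y = 0 then 1 else 0)
      + (if x + z = 0 then 1 else 0) + (if x - z = 0 then 1 else 0)
      + (if y + z = 0 then 1 else 0) + (if y - z = 0 then 1 else 0)
      + (if x + y + z = 0 then 1 else 0) + (if x + y - z = 0 then 1 else 0)
      + (if x - y + z = 0 then 1 else 0) + (if x - y - z = 0 then 1 else 0) := by
  have h01 : (0 : ZMod n) ≠ 1 := h10.symm
  have h11' : (-1 : ZMod n) ≠ 1 := h11.symm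
  have hm : (-1 : ZMod n) ≠ 0 := by simpa using h10
  have hm' : (0 : ZMod n) ≠ -1 := hm.symm
  unfold qmu queenU
  rw [Finset.card_filter]
  repeat rw [Finset.sum_insert (by
    simp only [Finset.mem_insert, Finset.mem_singleton, Prod.mk.injEq, h10, h01, h11, h11', hm, hm',
      and_false, false_and, or_false, not_false_eq_true, and_true])]
  rw [Finset.sum_singleton]
  simp only [qdot, mul_one, mul_zero, add_zero, zero_add, mul_neg, ← sub_eq_add_neg]
  ring

def qline {n : ℕ} (i : Fin 9) (t : ZMod n) : Z3 n :=
  match i with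
  | 0 => (t, 0, 0)
  | 1 => (0, t, 0)
  | 2 => (0, 0, t)
  | 3 => (t, t, 0)
  | 4 => (t, -t, 0)
  | 5 => (t, 0, t)
  | 6 => (t, 0, -t)
  | 7 => (0, t, t)
  | 8 => (0, t, -t)

lemma qmu_line (n : ℕ) (h10 : (1 : ZMod n) ≠ 0) (h2 : ∀ t : ZMod n, t + t = 0 → t = 0)
    (i : Fin 9) (t : ZMod n) (ht : t ≠ 0) : qmu n (qline i t) = 4 := by
  have h11 : (1 : ZMod n) ≠ -1 := fun h => h10 (h2 1 (by nth_rewrite 1 [h]; ring))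
  have ht2 : t + t ≠ 0 := fun h => ht (h2 t h)
  have ht3 : -t - t ≠ 0 := fun h => ht2 (by linear_combination -h)
  have ht4 : -t + -t ≠ 0 := fun h => ht2 (by linear_combination -h)
  fin_cases i <;> simp [qline, qmu_eq n h10 h11, ht, ht2, ht3, ht4]

lemma qmu_four (n : ℕ) (h10 : (1 : ZMod n) ≠ 0) (h2 : ∀ t : ZMod n, t + t = 0 → t = 0)
    (h3 : ∀ t : ZMod n, t + t + t = 0 → t = 0)
    (x y z : ZMod n) (h : qmu n (x, y, z) = 4) : ∃ i t, t ≠ 0 ∧ qline i t = (x, y, z) := by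
  have h11 : (1 : ZMod n) ≠ -1 := fun h => h10 (h2 1 (by nth_rewrite 1 [h]; ring))
  rw [qmu_eq n h10 h11] at h
  have a1 := h2 x
  have a2 := h2 y
  have a3 := h2 z
  by_cases hx : x = 0
  · subst hx
    by_cases hy : y = 0
    · subst hy
      by_cases hz : z = 0
      · subst hz; simp at h
      · exact ⟨2, z, hz, rfl⟩
    · by_cases hz : z = 0
      · subst hz; exact ⟨1, y, hy, rfl⟩
      · by_cases e : y - z = 0
        · exact ⟨7, y, hy, by simp [qline]; grind⟩
        · by_cases e' : y + z = 0
          · exact ⟨8, y, hy, by simp [qline]; grind⟩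
          · exfalso; grind
  by_cases hy : y = 0
  · subst hy
    by_cases hz : z = 0
    · subst hz; exact ⟨0, x, hx, rfl⟩
    · by_cases e : x - z = 0
      · exact ⟨5, x, hx, by simp [qline]; grind⟩
      · by_cases e' : x + z = 0
        · exact ⟨6, x, hx, by simp [qline]; grind⟩
        · exfalso; grind
  by_cases hz : z = 0
  · subst hz
    by_cases e : x - y = 0
    · exact ⟨3, x, hx, by simp [qline]; grind⟩
    · by_cases e' : x + y = 0
      · exact ⟨4, x, hx, by simp [qline]; grind⟩
      · exfalso; grind
  exfalso
  have b1 := h3 x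
  have b2 := h3 y
  have b3 := h3 z
  have c1 := h2 (x + x)
  have c2 := h2 (y + y)
  have c3 := h2 (z + z)
  by_cases e1 : x - y = 0
  · grind
  by_cases e2 : x + y = 0
  · grind
  by_cases e3 : x - z = 0
  · grind
  by_cases e4 : x + z = 0
  · grind
  by_cases e5 : y - z = 0
  · grind
  by_cases e6 : y + z = 0
  · grind
  grind

lemma qline_inj (n : ℕ) (h2 : ∀ t : ZMod n, t + t = 0 → t = 0) (i j : Fin 9) (s t : ZMod n)
    (hs : s ≠ 0) (ht : t ≠ 0) (h : qline i s = qline j t) : i = j ∧ s = t := by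
  have a1 := h2 s
  have a2 := h2 t
  fin_cases i <;> fin_cases j <;> simp [qline] at h ⊢ <;> grind

theorem stmt13 (n : ℕ) (hn : 5 ≤ n) (hodd : Odd n) (h3 : ¬ (3 ∣ n)) :
    {a : Z3 n | qmu n a = 4}.ncard = 9 * (n - 1) := by
  have : Fact (1 < n) := ⟨by omega⟩
  have : NeZero n := ⟨by omega⟩
  have h10 : (1 : ZMod n) ≠ 0 := one_ne_zero
  have u2 : IsUnit ((2 : ℕ) : ZMod n) :=
    (ZMod.isUnit_iff_coprime 2 n).2 (Nat.coprime_two_left.2 hodd)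
  have u3 : IsUnit ((3 : ℕ) : ZMod n) :=
    (ZMod.isUnit_iff_coprime 3 n).2 ((Nat.Prime.coprime_iff_not_dvd Nat.prime_three).2 h3)
  have k2 : ∀ t : ZMod n, t + t = 0 → t = 0 := fun t h =>
    (u2.mul_right_eq_zero).1 (by push_cast; linear_combination h)
  have k3 : ∀ t : ZMod n, t + t + t = 0 → t = 0 := fun t h =>
    (u3.mul_right_eq_zero).1 (by push_cast; linear_combination h)
  have hS : {a : Z3 n | qmu n a = 4} =
      Set.range (fun p : Fin 9 × {t : ZMod n // t ≠ 0} => qline p.1 p.2.1) := by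
    ext ⟨x, y, z⟩
    constructor
    · intro h
      obtain ⟨i, t, ht, e⟩ := qmu_four n h10 k2 k3 x y z h
      exact ⟨(i, ⟨t, ht⟩), e⟩
    · rintro ⟨⟨i, t, ht⟩, e⟩
      have := qmu_line n h10 k2 i t ht
      simp only at e
      rw [e] at this
      exact this
  rw [hS, ← Nat.card_coe_set_eq, Nat.card_range_of_injective]
  · simp [Nat.card_prod, Fintype.card_subtype_compl, ZMod.card]
  · rintro ⟨i, s, hs⟩ ⟨j, t, ht⟩ h
    obtain ⟨rfl, rfl⟩ := qline_inj n k2 i j s t hs ht h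
    rfl
end

section
/- Let n ≥ 5 be odd with 3 ∤ n. The number of a ∈ (ZMod n)^3 with μ(a) = 3 is exactly 4(n − 1). -/
open scoped Classical

lemma aux_sum (n : ℕ) (h2 : ∀ x : ZMod n, 2 * x = 0 → x = 0) (h1 : (1 : ZMod n) ≠ 0)
    (a b c : ZMod n) :
    qmu n (a, b, c) = (if a = 0 then 1 else 0) + ((if b = 0 then 1 else 0) +
      ((if c = 0 then 1 else 0) + ((if a + b = 0 then 1 else 0) + ((if a - b = 0 then 1 else 0) +
      ((if a + c = 0 then 1 else 0) + ((if a - c = 0 then 1 else 0) +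
      ((if b + c = 0 then 1 else 0) + ((if b - c = 0 then 1 else 0) +
      ((if a + b + c = 0 then 1 else 0) + ((if a + b - c = 0 then 1 else 0) +
      ((if a - b + c = 0 then 1 else 0) + (if a - b - c = 0 then 1 else 0)))))))))))) := by
  have hm : (1 : ZMod n) ≠ -1 := by
    intro h
    apply h1
    apply h2
    linear_combination h
  have hm' : (-1 : ZMod n) ≠ 1 := hm.symm
  have h1' : (0 : ZMod n) ≠ 1 := h1.symm
  unfold qmu queenU
  rw [Finset.card_filter]
  repeat rw [Finset.sum_insert (by simp [h1, h1', hm, hm'])]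
  rw [Finset.sum_singleton]
  simp [qdot, sub_eq_add_neg]

lemma aux_char (n : ℕ) (h2 : ∀ x : ZMod n, 2 * x = 0 → x = 0)
    (h3 : ∀ x : ZMod n, 3 * x = 0 → x = 0) (h1 : (1 : ZMod n) ≠ 0) (a b c : ZMod n) :
    qmu n (a, b, c) = 3 ↔ a ≠ 0 ∧ (b = a ∨ b = -a) ∧ (c = a ∨ c = -a) := by
  rw [aux_sum n h2 h1]
  have h2a := h2 a
  have h2b := h2 b
  have h2c := h2 c
  have h3a := h3 a
  have h3b := h3 b
  have h3c := h3 c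
  clear h2 h3
  by_cases ha : a = 0
  · subst ha
    grind (splits := 30)
  by_cases hb : b = 0
  · subst hb
    grind (splits := 30)
  by_cases hc : c = 0
  · subst hc
    grind (splits := 30)
  by_cases e1 : b = a
  · subst e1
    grind (splits := 30)
  by_cases e2 : b = -a
  · subst e2
    grind (splits := 30)
  by_cases e3 : c = a
  · subst e3
    grind (splits := 30)
  by_cases e4 : c = -a
  · subst e4
    grind (splits := 30)
  by_cases e5 : c = b
  · subst e5
    grind (splits := 30)
  by_cases e6 : c = -b
  · subst e6
    grind (splits := 30)
  grind (splits := 30)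

/-- Multiplicity count: the number of frequencies with `μ(a) = 3` is
exactly `4 * (n - 1)`. -/
theorem stmt14 (n : ℕ) (hn : 5 ≤ n) (hodd : Odd n) (h3 : ¬ (3 ∣ n)) :
    {a : Z3 n | qmu n a = 3}.ncard = 4 * (n - 1) := by
  have : NeZero n := ⟨by omega⟩
  have : Fact (1 < n) := ⟨by omega⟩
  have h1 : (1 : ZMod n) ≠ 0 := one_ne_zero
  have k2 : ∀ x : ZMod n, 2 * x = 0 → x = 0 := by
    have hu : IsUnit ((2 : ℕ) : ZMod n) :=
      (ZMod.isUnit_iff_coprime 2 n).2 (Nat.coprime_two_left.2 hodd)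
    intro x hx
    exact (hu.mul_right_eq_zero).1 (by exact_mod_cast hx)
  have k3 : ∀ x : ZMod n, 3 * x = 0 → x = 0 := by
    have hu : IsUnit ((3 : ℕ) : ZMod n) :=
      (ZMod.isUnit_iff_coprime 3 n).2 ((Nat.Prime.coprime_iff_not_dvd Nat.prime_three).2 h3)
    intro x hx
    exact (hu.mul_right_eq_zero).1 (by exact_mod_cast hx)
  let S : Finset (ZMod n × Bool × Bool) := (Finset.univ.erase 0) ×ˢ Finset.univ
  let f : ZMod n × Bool × Bool → Z3 n :=
    fun p => (p.1, (if p.2.1 then p.1 else -p.1), (if p.2.2 then p.1 else -p.1))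
  have hS : {a : Z3 n | qmu n a = 3} = ((S.image f : Finset (Z3 n)) : Set (Z3 n)) := by
    ext ⟨a, b, c⟩
    rw [Set.mem_ofPred_eq, aux_char n k2 k3 h1]
    simp only [S, f, Finset.coe_image, Set.mem_image, Finset.mem_coe, Finset.mem_product,
      Finset.mem_erase, Finset.mem_univ, and_true, Prod.exists, Bool.exists_bool, Prod.mk.injEq]
    constructor
    · rintro ⟨h0, hb, hc⟩
      refine ⟨a, ?_⟩
      rcases hb with rfl | rfl <;> rcases hc with rfl | rfl <;> simp [h0]
    · rintro ⟨x, h⟩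
      grind
  have hne : ∀ x : ZMod n, x ≠ 0 → x ≠ -x := by
    intro x hx h
    exact hx (k2 x (by linear_combination h))
  rw [hS, Set.ncard_coe_finset, Finset.card_image_of_injOn]
  · simp [S, Finset.card_product, ZMod.card]
    ring
  · rintro ⟨x, s, t⟩ hx ⟨y, s', t'⟩ hy h
    have hx0 : x ≠ 0 := by simpa [S] using hx
    have := hne x hx0
    simp only [f, Prod.mk.injEq] at h
    obtain ⟨rfl, h4, h5⟩ := h
    cases s <;> cases t <;> cases s' <;> cases t' <;> grind
end

section
/- Let n ≥ 5 be odd with 3 ∤ n. The number of a ∈ (ZMod n)^3 with μ(a) = 2 is exactly 12(n − 1). -/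
open scoped Classical

/-- Direction parametrization: the coordinate `p` carries `± 2 t`, the others `t`, `± t`. -/
def qdir (n : ℕ) (i : (Fin 3 × Bool × Bool) × ZMod n) : Z3 n :=
  let t := i.2
  let e := if i.1.2.1 then t else -t
  let d := if i.1.2.2 then 2 * t else -(2 * t)
  match i.1.1 with
  | 0 => (d, t, e)
  | 1 => (t, d, e)
  | 2 => (t, e, d)

lemma qmu_sum (n : ℕ) (h10 : (1 : ZMod n) ≠ 0) (h2 : (1 : ZMod n) ≠ -1) (x y z : ZMod n) :
    qmu n (x, y, z) = (if x = 0 then 1 else 0) + (if y = 0 then 1 else 0)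
      + (if z = 0 then 1 else 0) + (if x + y = 0 then 1 else 0) + (if x - y = 0 then 1 else 0)
      + (if x + z = 0 then 1 else 0) + (if x - z = 0 then 1 else 0)
      + (if y + z = 0 then 1 else 0) + (if y - z = 0 then 1 else 0)
      + (if x + y + z = 0 then 1 else 0) + (if x + y - z = 0 then 1 else 0)
      + (if x - y + z = 0 then 1 else 0) + (if x - y - z = 0 then 1 else 0) := by
  have h2' : (-1 : ZMod n) ≠ 1 := fun h => h2 h.symm
  have h10' : (0 : ZMod n) ≠ 1 := fun h => h10 h.symm
  have h01 : (0 : ZMod n) ≠ -1 := by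
    intro h; apply h10; linear_combination h
  unfold qmu queenU
  rw [Finset.card_filter]
  repeat rw [Finset.sum_insert (by
    simp [h10, h2, h2', h10', h01])]
  rw [Finset.sum_singleton]
  simp only [qdot, mul_one, mul_zero, add_zero, zero_add, mul_neg, ← sub_eq_add_neg, add_assoc,
    sub_eq_add_neg]

lemma qmu_two_of (n : ℕ) (h10 : (1 : ZMod n) ≠ 0) (h2 : (1 : ZMod n) ≠ -1)
    (c2 : ∀ x : ZMod n, 2 * x = 0 → x = 0) (c3 : ∀ x : ZMod n, 3 * x = 0 → x = 0)
    (k : Fin 3 × Bool × Bool) (t : ZMod n) (ht : t ≠ 0) : qmu n (qdir n (k, t)) = 2 := by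
  have t2 : 2 * t ≠ 0 := fun h => ht (c2 t h)
  have t3 : 3 * t ≠ 0 := fun h => ht (c3 t h)
  have t4 : 4 * t ≠ 0 := fun h => t2 (c2 _ (by linear_combination h))
  obtain ⟨p, e, d⟩ := k
  fin_cases p <;> cases e <;> cases d <;> simp only [qdir] <;> simp only [if_true, if_false, Bool.false_eq_true, reduceCtorEq] <;>
    rw [qmu_sum n h10 h2] <;> ring_nf <;> ring_nf at t2 t3 t4 <;> simp [ht, t2, t3, t4]

lemma qmu_two_imp (n : ℕ) (h10 : (1 : ZMod n) ≠ 0) (h2 : (1 : ZMod n) ≠ -1)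
    (c2 : ∀ x : ZMod n, 2 * x = 0 → x = 0)
    (x y z : ZMod n) (h : qmu n (x, y, z) = 2) :
    ∃ k t, t ≠ 0 ∧ qdir n (k, t) = (x, y, z) := by
  rw [qmu_sum n h10 h2] at h
  have hx : x ≠ 0 := by
    rintro rfl
    simp only [zero_add, zero_sub, neg_eq_zero] at h
    have e1 : (-y + z = 0) ↔ (y - z = 0) := by grind
    have e2 : (-y - z = 0) ↔ (y + z = 0) := by grind
    simp only [e1, e2, if_true] at h
    omega
  have hy : y ≠ 0 := by
    rintro rfl
    simp only [zero_add, zero_sub, neg_eq_zero, add_zero, sub_zero] at h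
    simp only [if_true] at h
    omega
  have hz : z ≠ 0 := by
    rintro rfl
    simp only [add_zero, sub_zero] at h
    simp only [if_true] at h
    omega
  have x2 : 2 * x ≠ 0 := fun h => hx (c2 _ h)
  have y2 : 2 * y ≠ 0 := fun h => hy (c2 _ h)
  have z2 : 2 * z ≠ 0 := fun h => hz (c2 _ h)
  have key : (x + y = 0 ∧ x - y - z = 0) ∨ (x + y = 0 ∧ x - y + z = 0) ∨
      (x - y = 0 ∧ x + y + z = 0) ∨ (x - y = 0 ∧ x + y - z = 0) ∨
      (x + z = 0 ∧ x - y - z = 0) ∨ (x + z = 0 ∧ x + y - z = 0) ∨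
      (x - z = 0 ∧ x + y + z = 0) ∨ (x - z = 0 ∧ x - y + z = 0) ∨
      (y + z = 0 ∧ x + y - z = 0) ∨ (y + z = 0 ∧ x - y + z = 0) ∨
      (y - z = 0 ∧ x + y + z = 0) ∨ (y - z = 0 ∧ x - y - z = 0) := by
    simp only [hx, hy, hz, if_false] at h
    by_cases a1 : x + y = 0
    · obtain rfl : y = -x := by linear_combination a1
      have e1 : (-x + z = 0) ↔ (x - z = 0) := by grind
      have e2 : (-x - z = 0) ↔ (x + z = 0) := by grind
      grind
    by_cases a2 : x - y = 0
    · obtain rfl : y = x := by linear_combination -a2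
      grind
    by_cases a3 : x + z = 0
    · obtain rfl : z = -x := by linear_combination a3
      grind
    by_cases a4 : x - z = 0
    · obtain rfl : z = x := by linear_combination -a4
      grind
    by_cases a5 : y + z = 0
    · obtain rfl : z = -y := by linear_combination a5
      grind
    by_cases a6 : y - z = 0
    · obtain rfl : z = y := by linear_combination -a6
      grind
    exfalso
    have b1 := fun h => a1 (c2 _ h)
    have b2 := fun h => a2 (c2 _ h)
    have b3 := fun h => a3 (c2 _ h)
    have b4 := fun h => a4 (c2 _ h)
    have b5 := fun h => a5 (c2 _ h)
    have b6 := fun h => a6 (c2 _ h)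
    simp only [a1, a2, a3, a4, a5, a6, if_false] at h
    grind
  rcases key with ⟨a, b⟩ | ⟨a, b⟩ | ⟨a, b⟩ | ⟨a, b⟩ | ⟨a, b⟩ | ⟨a, b⟩ | ⟨a, b⟩ | ⟨a, b⟩ |
    ⟨a, b⟩ | ⟨a, b⟩ | ⟨a, b⟩ | ⟨a, b⟩
  · exact ⟨(2, false, true), x, hx, by simp [qdir]; grind⟩
  · exact ⟨(2, false, false), x, hx, by simp [qdir]; grind⟩
  · exact ⟨(2, true, false), x, hx, by simp [qdir]; grind⟩
  · exact ⟨(2, true, true), x, hx, by simp [qdir]; grind⟩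
  · exact ⟨(1, false, true), x, hx, by simp [qdir]; grind⟩
  · exact ⟨(1, false, false), x, hx, by simp [qdir]; grind⟩
  · exact ⟨(1, true, false), x, hx, by simp [qdir]; grind⟩
  · exact ⟨(1, true, true), x, hx, by simp [qdir]; grind⟩
  · exact ⟨(0, false, false), y, hy, by simp [qdir]; grind⟩
  · exact ⟨(0, false, true), y, hy, by simp [qdir]; grind⟩
  · exact ⟨(0, true, false), y, hy, by simp [qdir]; grind⟩
  · exact ⟨(0, true, true), y, hy, by simp [qdir]; grind⟩

set_option maxHeartbeats 4000000 in
lemma qdir_inj (n : ℕ)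
    (c2 : ∀ x : ZMod n, 2 * x = 0 → x = 0) (c3 : ∀ x : ZMod n, 3 * x = 0 → x = 0)
    (k l : Fin 3 × Bool × Bool) (t s : ZMod n) (ht : t ≠ 0)
    (h : qdir n (k, t) = qdir n (l, s)) : (k, t) = (l, s) := by
  have t2 : 2 * t ≠ 0 := fun h => ht (c2 t h)
  have t3 : 3 * t ≠ 0 := fun h => ht (c3 t h)
  have t4 : 4 * t ≠ 0 := fun h => t2 (c2 _ (by linear_combination h))
  obtain ⟨p, e, d⟩ := k
  obtain ⟨q, e', d'⟩ := l
  fin_cases p <;> fin_cases q <;> cases e <;> cases d <;> cases e' <;> cases d' <;>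
    simp [qdir] at h ⊢ <;> grind

/-- Multiplicity count: the number of frequencies with `μ(a) = 2` is
exactly `12 * (n - 1)`. -/
theorem stmt15 (n : ℕ) (hn : 5 ≤ n) (hodd : Odd n) (h3 : ¬ (3 ∣ n)) :
    {a : Z3 n | qmu n a = 2}.ncard = 12 * (n - 1) := by
  have : NeZero n := ⟨by omega⟩
  have cop : ∀ m : ℕ, Nat.Coprime m n → ∀ x : ZMod n, (m : ZMod n) * x = 0 → x = 0 := by
    intro m hm x hx
    exact ((ZMod.isUnit_iff_coprime m n).2 hm).mul_right_eq_zero.1 hx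
  have c2 : ∀ x : ZMod n, 2 * x = 0 → x = 0 := by
    simpa using cop 2 (Nat.coprime_two_left.2 hodd)
  have c3 : ∀ x : ZMod n, 3 * x = 0 → x = 0 := by
    simpa using cop 3 ((Nat.Prime.coprime_iff_not_dvd Nat.prime_three).2 h3)
  have : Fact (1 < n) := ⟨by omega⟩
  have h10 : (1 : ZMod n) ≠ 0 := one_ne_zero
  have h2 : (1 : ZMod n) ≠ -1 := by
    intro h
    exact h10 (c2 1 (by linear_combination h))
  have hset : {a : Z3 n | qmu n a = 2} =
      (((Finset.univ : Finset (Fin 3 × Bool × Bool)) ×ˢ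
        ((Finset.univ : Finset (ZMod n)).erase 0)).image (qdir n) : Finset (Z3 n)) := by
    ext ⟨x, y, z⟩
    simp only [Set.mem_ofPred_eq, Finset.coe_image, Set.mem_image, Finset.mem_coe,
      Finset.mem_product, Finset.mem_univ, true_and, Finset.mem_erase, and_true]
    constructor
    · intro h
      obtain ⟨k, t, ht, e⟩ := qmu_two_imp n h10 h2 c2 x y z h
      exact ⟨(k, t), ht, e⟩
    · rintro ⟨⟨k, t⟩, ht, e⟩
      rw [← e]
      exact qmu_two_of n h10 h2 c2 c3 k t ht
  rw [hset, Set.ncard_coe_finset, Finset.card_image_of_injOn, Finset.card_product,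
    Finset.card_erase_of_mem (Finset.mem_univ _), Finset.card_univ, Finset.card_univ, ZMod.card]
  · simp
  · rintro ⟨k, t⟩ h1 ⟨l, s⟩ _ h
    have ht : t ≠ 0 := by simpa using h1
    exact qdir_inj n c2 c3 k l t s ht h
end

section
/- Let n ≥ 5 be odd with 3 ∤ n. The number of a ∈ (ZMod n)^3 with μ(a) = 1 is exactly 13n² − 72n + 59. -/
open scoped Classical

lemma card_fib {n : ℕ} [NeZero n] (k : ℕ) (T : ZMod n → Finset (ZMod n))
    (hT : ∀ s, s ≠ 0 → (T s).card = k) :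
    ((Finset.univ.filter (fun p : ZMod n × ZMod n => p.1 ≠ 0 ∧ p.2 ∉ T p.1)).card : ℤ)
      = ((n : ℤ) - 1) * ((n : ℤ) - k) := by
  have h1 : (Finset.univ.filter (fun p : ZMod n × ZMod n => p.1 ≠ 0 ∧ p.2 ∉ T p.1))
      = ((Finset.univ.erase (0 : ZMod n)).sigma (fun s => (T s)ᶜ)).map
        (Equiv.sigmaEquivProd (ZMod n) (ZMod n)).toEmbedding := by
    ext ⟨s, t⟩
    simp [Equiv.sigmaEquivProd]
  rw [h1, Finset.card_map, Finset.card_sigma]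
  push_cast
  have h2 : ∀ s ∈ Finset.univ.erase (0 : ZMod n), (((T s)ᶜ.card : ℕ) : ℤ) = (n : ℤ) - k := by
    intro s hs
    have hs0 : s ≠ 0 := by simpa using hs
    have := Finset.card_add_card_compl (T s)
    rw [hT s hs0, ZMod.card] at this
    omega
  rw [Finset.sum_congr rfl h2, Finset.sum_const, Finset.card_erase_of_mem (Finset.mem_univ _),
    Finset.card_univ, ZMod.card, nsmul_eq_mul]
  have : 1 ≤ n := NeZero.one_le
  push_cast [Nat.cast_sub this]
  ring

lemma card_param {n : ℕ} [NeZero n] (k : ℕ) (T : ZMod n → Finset (ZMod n))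
    (hT : ∀ s, s ≠ 0 → (T s).card = k) (Q : Z3 n → Prop)
    (f : ZMod n × ZMod n → Z3 n) (g : Z3 n → ZMod n × ZMod n)
    (hgf : ∀ p, g (f p) = p)
    (hfg : ∀ a, Q a → f (g a) = a)
    (hQ : ∀ s t, Q (f (s, t)) ↔ s ≠ 0 ∧ t ∉ T s) :
    ((Finset.univ.filter Q).card : ℤ) = ((n : ℤ) - 1) * ((n : ℤ) - k) := by
  rw [← card_fib k T hT]
  congr 1
  refine Finset.card_nbij' g f ?_ ?_ ?_ ?_
  · intro a ha
    have ha : Q a := by simpa using ha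
    have := (hQ (g a).1 (g a).2).1 (by simpa [hfg a ha] using ha)
    simpa using this
  · rintro ⟨s, t⟩ hp
    have : s ≠ 0 ∧ t ∉ T s := by simpa using hp
    simpa using (hQ s t).2 this
  · intro a ha
    exact hfg a (by simpa using ha)
  · intro p _
    exact hgf p

lemma card_one {α β : Type*} [Fintype α] (U : Finset β) (P : α → β → Prop) :
    (Finset.univ.filter (fun a => (U.filter (P a)).card = 1)).card
      = ∑ u ∈ U, (Finset.univ.filter (fun a => ∀ v ∈ U, P a v ↔ v = u)).card := by
  rw [← Finset.card_biUnion]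
  · congr 1
    ext a
    simp only [Finset.mem_filter, Finset.mem_univ, true_and, Finset.mem_biUnion,
      Finset.card_eq_one]
    constructor
    · rintro ⟨u, hu⟩
      have hu' : u ∈ U.filter (P a) := by simp [hu]
      refine ⟨u, (Finset.mem_filter.1 hu').1, fun v hv => ⟨fun h => ?_, ?_⟩⟩
      · have : v ∈ U.filter (P a) := by simp [hv, h]
        simpa [hu] using this
      · rintro rfl
        exact (Finset.mem_filter.1 hu').2
    · rintro ⟨u, hu, h⟩
      refine ⟨u, ?_⟩
      ext v
      simp only [Finset.mem_filter, Finset.mem_singleton]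
      constructor
      · rintro ⟨h1, h2⟩
        exact (h v h1).1 h2
      · rintro rfl
        exact ⟨hu, (h v hu).2 rfl⟩
  · intro u hu v hv huv
    refine Finset.disjoint_left.2 fun a h1 h2 => huv ?_
    simp only [Finset.mem_filter, Finset.mem_univ, true_and] at h1 h2
    exact (h2 u hu).1 ((h1 u hu).2 rfl)

lemma cardA {n : ℕ} (h2 : ∀ x : ZMod n, 2 * x = 0 → x = 0) (s : ZMod n) (hs : s ≠ 0) :
    ({0, s, -s} : Finset (ZMod n)).card = 3 := by
  have := h2 s
  rw [Finset.card_eq_three]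
  exact ⟨0, s, -s, by grind, by grind, by grind, rfl⟩

lemma cardB {n : ℕ} (h2 : ∀ x : ZMod n, 2 * x = 0 → x = 0)
    (h3 : ∀ x : ZMod n, 3 * x = 0 → x = 0) (s : ZMod n) (hs : s ≠ 0) :
    ({0, s, -s, 2 * s, -(2 * s)} : Finset (ZMod n)).card = 5 := by
  have a2 := h2 s
  have a4 := h2 (2 * s)
  have a3 := h3 s
  repeat rw [Finset.card_insert_of_notMem]
  · simp
  all_goals simp only [Finset.mem_insert, Finset.mem_singleton]; grind

lemma cardC {n : ℕ} (h2 : ∀ x : ZMod n, 2 * x = 0 → x = 0)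
    (h3 : ∀ x : ZMod n, 3 * x = 0 → x = 0) (s : ZMod n) (hs : s ≠ 0) :
    ({0, -s, 2 * s, -(2 * s), -(4 * s)} : Finset (ZMod n)).card = 5 := by
  have a2 := h2 s
  have a4 := h2 (2 * s)
  have a3 := h3 s
  have a6 := h2 (3 * s)
  repeat rw [Finset.card_insert_of_notMem]
  · simp
  all_goals simp only [Finset.mem_insert, Finset.mem_singleton]; grind

/-- The direction `u` is the only one orthogonal to `a`. -/
def OnlyAt (n : ℕ) (u a : Z3 n) : Prop := ∀ v ∈ queenU n, qdot a v = 0 ↔ v = u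

/-- The number of `a` for which `u` is the only orthogonal direction. -/
noncomputable def cnt (n : ℕ) [NeZero n] (u : Z3 n) : ℤ :=
  ((Finset.univ.filter (OnlyAt n u)).card : ℤ)

lemma forall13 (n : ℕ) (P : Z3 n → Prop) : (∀ v ∈ queenU n, P v) ↔
    P (1,0,0) ∧ P (0,1,0) ∧ P (0,0,1) ∧ P (1,1,0) ∧ P (1,-1,0) ∧ P (1,0,1) ∧ P (1,0,-1) ∧
    P (0,1,1) ∧ P (0,1,-1) ∧ P (1,1,1) ∧ P (1,1,-1) ∧ P (1,-1,1) ∧ P (1,-1,-1) := by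
  simp only [queenU, Finset.mem_insert, Finset.mem_singleton, forall_eq_or_imp, forall_eq]

set_option maxHeartbeats 8000000 in
/-- Multiplicity count: the number of frequencies with `μ(a) = 1` is exactly
`13n² − 72n + 59` (stated in `ℤ` to avoid truncated subtraction). -/
theorem stmt16 (n : ℕ) (hn : 5 ≤ n) (hodd : Odd n) (h3 : ¬ (3 ∣ n)) :
    ({a : Z3 n | qmu n a = 1}.ncard : ℤ)
      = 13 * (n : ℤ) ^ 2 - 72 * (n : ℤ) + 59 := by
  have : NeZero n := ⟨by omega⟩
  obtain ⟨h, hh⟩ : ∃ h : ZMod n, 2 * h = 1 :=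
    ⟨_, by simpa using ZMod.coe_mul_inv_eq_one (n := n) 2 (Nat.coprime_two_left.2 hodd)⟩
  have h3' : Nat.Coprime 3 n := (Nat.Prime.coprime_iff_not_dvd Nat.prime_three).2 h3
  obtain ⟨c, hc⟩ : ∃ h : ZMod n, 3 * h = 1 :=
    ⟨_, by simpa using ZMod.coe_mul_inv_eq_one (n := n) 3 h3'⟩
  have k2 : ∀ x : ZMod n, 2 * x = 0 → x = 0 := fun x hx => by
    linear_combination h * hx - x * hh
  have k3 : ∀ x : ZMod n, 3 * x = 0 → x = 0 := fun x hx => by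
    linear_combination c * hx - x * hc
  have : Fact (1 < n) := ⟨by omega⟩
  have e1 : (1 : ZMod n) ≠ 0 := one_ne_zero
  have e2 : (1 : ZMod n) ≠ -1 := fun e => e1 (k2 1 (by linear_combination e))
  have e3 : (-1 : ZMod n) ≠ 1 := e2.symm
  have e4 : (0 : ZMod n) ≠ 1 := e1.symm
  have e5 : (0 : ZMod n) ≠ -1 := by simp
  have e6 : (-1 : ZMod n) ≠ 0 := e5.symm
  have key : ({a : Z3 n | qmu n a = 1}.ncard : ℤ) = ∑ u ∈ queenU n, cnt n u := by
    have hc1 := card_one (queenU n) (fun (a : Z3 n) v => qdot a v = 0)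
    unfold cnt
    rw [← Nat.cast_sum]
    refine congrArg Nat.cast (Eq.trans ?_ (hc1.trans ?_))
    · rw [← Set.ncard_coe_finset]
      congr 1
      ext a
      simp only [qmu, Set.mem_setOf_eq, Finset.coe_filter, Finset.mem_univ, true_and]
      congr!
    · refine Finset.sum_congr rfl fun u _ => ?_
      congr!
  have c0 : cnt n (1, 0, 0) = _ := card_param 3 (fun s : ZMod n => {0, s, -s}) (cardA k2)
    (OnlyAt n (1, 0, 0))
    (fun p => (0, p.1, p.2)) (fun a => (a.2.1, a.2.2))
    (by rintro ⟨s, t⟩; refine Prod.ext ?_ ?_ <;> clear key <;> grind)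
    (by
      rintro ⟨x, y, z⟩ hQ
      have := (hQ (1, 0, 0) (by simp [queenU])).2 rfl
      simp only [qdot] at this
      clear hQ key
      refine Prod.ext ?_ (Prod.ext ?_ ?_) <;> grind)
    (by
      intro s t
      have := k2 s
      have := k2 t
      have := k2 (2 * s)
      have := k2 (s + t)
      have := k2 (2 * s + t)
      clear key k2 k3 hh hc
      simp only [OnlyAt, forall13, qdot, Finset.mem_singleton,
        Finset.mem_insert, Prod.mk.injEq, e1, e2, e3, e4, e5, e6, and_true, and_false, true_and,
        false_and, iff_true, iff_false]
      clear e1 e2 e3 e4 e5 e6 hn hodd h3 h3'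
      grind (splits := 40))
  have c1 : cnt n (0, 1, 0) = _ := card_param 3 (fun s : ZMod n => {0, s, -s}) (cardA k2)
    (OnlyAt n (0, 1, 0))
    (fun p => (p.1, 0, p.2)) (fun a => (a.1, a.2.2))
    (by rintro ⟨s, t⟩; refine Prod.ext ?_ ?_ <;> clear key <;> grind)
    (by
      rintro ⟨x, y, z⟩ hQ
      have := (hQ (0, 1, 0) (by simp [queenU])).2 rfl
      simp only [qdot] at this
      clear hQ key
      refine Prod.ext ?_ (Prod.ext ?_ ?_) <;> grind)
    (by
      intro s t
      have := k2 s
      have := k2 t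
      have := k2 (2 * s)
      have := k2 (s + t)
      have := k2 (2 * s + t)
      clear key k2 k3 hh hc
      simp only [OnlyAt, forall13, qdot, Finset.mem_singleton,
        Finset.mem_insert, Prod.mk.injEq, e1, e2, e3, e4, e5, e6, and_true, and_false, true_and,
        false_and, iff_true, iff_false]
      clear e1 e2 e3 e4 e5 e6 hn hodd h3 h3'
      grind (splits := 40))
  have c2 : cnt n (0, 0, 1) = _ := card_param 3 (fun s : ZMod n => {0, s, -s}) (cardA k2)
    (OnlyAt n (0, 0, 1))
    (fun p => (p.1, p.2, 0)) (fun a => (a.1, a.2.1))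
    (by rintro ⟨s, t⟩; refine Prod.ext ?_ ?_ <;> clear key <;> grind)
    (by
      rintro ⟨x, y, z⟩ hQ
      have := (hQ (0, 0, 1) (by simp [queenU])).2 rfl
      simp only [qdot] at this
      clear hQ key
      refine Prod.ext ?_ (Prod.ext ?_ ?_) <;> grind)
    (by
      intro s t
      have := k2 s
      have := k2 t
      have := k2 (2 * s)
      have := k2 (s + t)
      have := k2 (2 * s + t)
      clear key k2 k3 hh hc
      simp only [OnlyAt, forall13, qdot, Finset.mem_singleton,
        Finset.mem_insert, Prod.mk.injEq, e1, e2, e3, e4, e5, e6, and_true, and_false, true_and,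
        false_and, iff_true, iff_false]
      clear e1 e2 e3 e4 e5 e6 hn hodd h3 h3'
      grind (splits := 40))
  have c3 : cnt n (1, 1, 0) = _ := card_param 5 (fun s : ZMod n => {0, s, -s, 2 * s, -(2 * s)}) (cardB k2 k3)
    (OnlyAt n (1, 1, 0))
    (fun p => (-p.1, p.1, p.2)) (fun a => (-a.1, a.2.2))
    (by rintro ⟨s, t⟩; refine Prod.ext ?_ ?_ <;> clear key <;> grind)
    (by
      rintro ⟨x, y, z⟩ hQ
      have := (hQ (1, 1, 0) (by simp [queenU])).2 rfl
      simp only [qdot] at this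
      clear hQ key
      refine Prod.ext ?_ (Prod.ext ?_ ?_) <;> grind)
    (by
      intro s t
      have := k2 s
      have := k2 t
      have := k2 (2 * s)
      have := k2 (s + t)
      have := k2 (2 * s + t)
      clear key k2 k3 hh hc
      simp only [OnlyAt, forall13, qdot, Finset.mem_singleton,
        Finset.mem_insert, Prod.mk.injEq, e1, e2, e3, e4, e5, e6, and_true, and_false, true_and,
        false_and, iff_true, iff_false]
      clear e1 e2 e3 e4 e5 e6 hn hodd h3 h3'
      grind (splits := 40))
  have c4 : cnt n (1, -1, 0) = _ := card_param 5 (fun s : ZMod n => {0, s, -s, 2 * s, -(2 * s)}) (cardB k2 k3)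
    (OnlyAt n (1, -1, 0))
    (fun p => (-p.1, -(p.1), p.2)) (fun a => (-a.1, a.2.2))
    (by rintro ⟨s, t⟩; refine Prod.ext ?_ ?_ <;> clear key <;> grind)
    (by
      rintro ⟨x, y, z⟩ hQ
      have := (hQ (1, -1, 0) (by simp [queenU])).2 rfl
      simp only [qdot] at this
      clear hQ key
      refine Prod.ext ?_ (Prod.ext ?_ ?_) <;> grind)
    (by
      intro s t
      have := k2 s
      have := k2 t
      have := k2 (2 * s)
      have := k2 (s + t)
      have := k2 (2 * s + t)
      clear key k2 k3 hh hc
      simp only [OnlyAt, forall13, qdot, Finset.mem_singleton,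
        Finset.mem_insert, Prod.mk.injEq, e1, e2, e3, e4, e5, e6, and_true, and_false, true_and,
        false_and, iff_true, iff_false]
      clear e1 e2 e3 e4 e5 e6 hn hodd h3 h3'
      grind (splits := 40))
  have c5 : cnt n (1, 0, 1) = _ := card_param 5 (fun s : ZMod n => {0, s, -s, 2 * s, -(2 * s)}) (cardB k2 k3)
    (OnlyAt n (1, 0, 1))
    (fun p => (-p.1, p.2, p.1)) (fun a => (-a.1, a.2.1))
    (by rintro ⟨s, t⟩; refine Prod.ext ?_ ?_ <;> clear key <;> grind)
    (by
      rintro ⟨x, y, z⟩ hQ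
      have := (hQ (1, 0, 1) (by simp [queenU])).2 rfl
      simp only [qdot] at this
      clear hQ key
      refine Prod.ext ?_ (Prod.ext ?_ ?_) <;> grind)
    (by
      intro s t
      have := k2 s
      have := k2 t
      have := k2 (2 * s)
      have := k2 (s + t)
      have := k2 (2 * s + t)
      clear key k2 k3 hh hc
      simp only [OnlyAt, forall13, qdot, Finset.mem_singleton,
        Finset.mem_insert, Prod.mk.injEq, e1, e2, e3, e4, e5, e6, and_true, and_false, true_and,
        false_and, iff_true, iff_false]
      clear e1 e2 e3 e4 e5 e6 hn hodd h3 h3'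
      grind (splits := 40))
  have c6 : cnt n (1, 0, -1) = _ := card_param 5 (fun s : ZMod n => {0, s, -s, 2 * s, -(2 * s)}) (cardB k2 k3)
    (OnlyAt n (1, 0, -1))
    (fun p => (-p.1, p.2, -(p.1))) (fun a => (-a.1, a.2.1))
    (by rintro ⟨s, t⟩; refine Prod.ext ?_ ?_ <;> clear key <;> grind)
    (by
      rintro ⟨x, y, z⟩ hQ
      have := (hQ (1, 0, -1) (by simp [queenU])).2 rfl
      simp only [qdot] at this
      clear hQ key
      refine Prod.ext ?_ (Prod.ext ?_ ?_) <;> grind)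
    (by
      intro s t
      have := k2 s
      have := k2 t
      have := k2 (2 * s)
      have := k2 (s + t)
      have := k2 (2 * s + t)
      clear key k2 k3 hh hc
      simp only [OnlyAt, forall13, qdot, Finset.mem_singleton,
        Finset.mem_insert, Prod.mk.injEq, e1, e2, e3, e4, e5, e6, and_true, and_false, true_and,
        false_and, iff_true, iff_false]
      clear e1 e2 e3 e4 e5 e6 hn hodd h3 h3'
      grind (splits := 40))
  have c7 : cnt n (0, 1, 1) = _ := card_param 5 (fun s : ZMod n => {0, s, -s, 2 * s, -(2 * s)}) (cardB k2 k3)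
    (OnlyAt n (0, 1, 1))
    (fun p => (p.2, -p.1, p.1)) (fun a => (-a.2.1, a.1))
    (by rintro ⟨s, t⟩; refine Prod.ext ?_ ?_ <;> clear key <;> grind)
    (by
      rintro ⟨x, y, z⟩ hQ
      have := (hQ (0, 1, 1) (by simp [queenU])).2 rfl
      simp only [qdot] at this
      clear hQ key
      refine Prod.ext ?_ (Prod.ext ?_ ?_) <;> grind)
    (by
      intro s t
      have := k2 s
      have := k2 t
      have := k2 (2 * s)
      have := k2 (s + t)
      have := k2 (2 * s + t)
      clear key k2 k3 hh hc
      simp only [OnlyAt, forall13, qdot, Finset.mem_singleton,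
        Finset.mem_insert, Prod.mk.injEq, e1, e2, e3, e4, e5, e6, and_true, and_false, true_and,
        false_and, iff_true, iff_false]
      clear e1 e2 e3 e4 e5 e6 hn hodd h3 h3'
      grind (splits := 40))
  have c8 : cnt n (0, 1, -1) = _ := card_param 5 (fun s : ZMod n => {0, s, -s, 2 * s, -(2 * s)}) (cardB k2 k3)
    (OnlyAt n (0, 1, -1))
    (fun p => (p.2, -p.1, -(p.1))) (fun a => (-a.2.1, a.1))
    (by rintro ⟨s, t⟩; refine Prod.ext ?_ ?_ <;> clear key <;> grind)
    (by
      rintro ⟨x, y, z⟩ hQ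
      have := (hQ (0, 1, -1) (by simp [queenU])).2 rfl
      simp only [qdot] at this
      clear hQ key
      refine Prod.ext ?_ (Prod.ext ?_ ?_) <;> grind)
    (by
      intro s t
      have := k2 s
      have := k2 t
      have := k2 (2 * s)
      have := k2 (s + t)
      have := k2 (2 * s + t)
      clear key k2 k3 hh hc
      simp only [OnlyAt, forall13, qdot, Finset.mem_singleton,
        Finset.mem_insert, Prod.mk.injEq, e1, e2, e3, e4, e5, e6, and_true, and_false, true_and,
        false_and, iff_true, iff_false]
      clear e1 e2 e3 e4 e5 e6 hn hodd h3 h3'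
      grind (splits := 40))
  have c9 : cnt n (1, 1, 1) = _ := card_param 5 (fun s : ZMod n => {0, -s, 2 * s, -(2 * s), -(4 * s)}) (cardC k2 k3)
    (OnlyAt n (1, 1, 1))
    (fun p => (-2 * p.1 - p.2, 2 * p.1, p.2)) (fun a => (h * a.2.1, a.2.2))
    (by rintro ⟨s, t⟩; refine Prod.ext ?_ ?_ <;> clear key <;> grind)
    (by
      rintro ⟨x, y, z⟩ hQ
      have := (hQ (1, 1, 1) (by simp [queenU])).2 rfl
      simp only [qdot] at this
      clear hQ key
      refine Prod.ext ?_ (Prod.ext ?_ ?_) <;> grind)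
    (by
      intro s t
      have := k2 s
      have := k2 t
      have := k2 (2 * s)
      have := k2 (s + t)
      have := k2 (2 * s + t)
      clear key k2 k3 hh hc
      simp only [OnlyAt, forall13, qdot, Finset.mem_singleton,
        Finset.mem_insert, Prod.mk.injEq, e1, e2, e3, e4, e5, e6, and_true, and_false, true_and,
        false_and, iff_true, iff_false]
      clear e1 e2 e3 e4 e5 e6 hn hodd h3 h3'
      grind (splits := 40))
  have c10 : cnt n (1, 1, -1) = _ := card_param 5 (fun s : ZMod n => {0, -s, 2 * s, -(2 * s), -(4 * s)}) (cardC k2 k3)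
    (OnlyAt n (1, 1, -1))
    (fun p => (-2 * p.1 - p.2, 2 * p.1, -(p.2))) (fun a => (h * a.2.1, -(a.2.2)))
    (by rintro ⟨s, t⟩; refine Prod.ext ?_ ?_ <;> clear key <;> grind)
    (by
      rintro ⟨x, y, z⟩ hQ
      have := (hQ (1, 1, -1) (by simp [queenU])).2 rfl
      simp only [qdot] at this
      clear hQ key
      refine Prod.ext ?_ (Prod.ext ?_ ?_) <;> grind)
    (by
      intro s t
      have := k2 s
      have := k2 t
      have := k2 (2 * s)
      have := k2 (s + t)
      have := k2 (2 * s + t)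
      clear key k2 k3 hh hc
      simp only [OnlyAt, forall13, qdot, Finset.mem_singleton,
        Finset.mem_insert, Prod.mk.injEq, e1, e2, e3, e4, e5, e6, and_true, and_false, true_and,
        false_and, iff_true, iff_false]
      clear e1 e2 e3 e4 e5 e6 hn hodd h3 h3'
      grind (splits := 40))
  have c11 : cnt n (1, -1, 1) = _ := card_param 5 (fun s : ZMod n => {0, -s, 2 * s, -(2 * s), -(4 * s)}) (cardC k2 k3)
    (OnlyAt n (1, -1, 1))
    (fun p => (-2 * p.1 - p.2, -(2 * p.1), p.2)) (fun a => (-(h * a.2.1), a.2.2))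
    (by rintro ⟨s, t⟩; refine Prod.ext ?_ ?_ <;> clear key <;> grind)
    (by
      rintro ⟨x, y, z⟩ hQ
      have := (hQ (1, -1, 1) (by simp [queenU])).2 rfl
      simp only [qdot] at this
      clear hQ key
      refine Prod.ext ?_ (Prod.ext ?_ ?_) <;> grind)
    (by
      intro s t
      have := k2 s
      have := k2 t
      have := k2 (2 * s)
      have := k2 (s + t)
      have := k2 (2 * s + t)
      clear key k2 k3 hh hc
      simp only [OnlyAt, forall13, qdot, Finset.mem_singleton,
        Finset.mem_insert, Prod.mk.injEq, e1, e2, e3, e4, e5, e6, and_true, and_false, true_and,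
        false_and, iff_true, iff_false]
      clear e1 e2 e3 e4 e5 e6 hn hodd h3 h3'
      grind (splits := 40))
  have c12 : cnt n (1, -1, -1) = _ := card_param 5 (fun s : ZMod n => {0, -s, 2 * s, -(2 * s), -(4 * s)}) (cardC k2 k3)
    (OnlyAt n (1, -1, -1))
    (fun p => (-2 * p.1 - p.2, -(2 * p.1), -(p.2))) (fun a => (-(h * a.2.1), -(a.2.2)))
    (by rintro ⟨s, t⟩; refine Prod.ext ?_ ?_ <;> clear key <;> grind)
    (by
      rintro ⟨x, y, z⟩ hQ
      have := (hQ (1, -1, -1) (by simp [queenU])).2 rfl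
      simp only [qdot] at this
      clear hQ key
      refine Prod.ext ?_ (Prod.ext ?_ ?_) <;> grind)
    (by
      intro s t
      have := k2 s
      have := k2 t
      have := k2 (2 * s)
      have := k2 (s + t)
      have := k2 (2 * s + t)
      clear key k2 k3 hh hc
      simp only [OnlyAt, forall13, qdot, Finset.mem_singleton,
        Finset.mem_insert, Prod.mk.injEq, e1, e2, e3, e4, e5, e6, and_true, and_false, true_and,
        false_and, iff_true, iff_false]
      clear e1 e2 e3 e4 e5 e6 hn hodd h3 h3'
      grind (splits := 40))
  rw [key]
  unfold queenU
  repeat rw [Finset.sum_insert (by simp [e1, e2, e3, e4, e5, e6])]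
  rw [Finset.sum_singleton, c0, c1, c2, c3, c4, c5, c6, c7, c8, c9, c10, c11, c12]
  push_cast
  ring
end

section
/- Let n ≥ 5 be odd with 3 ∤ n. The number of a ∈ (ZMod n)^3 with μ(a) = 0 is exactly n³ − 13n² + 47n − 35. -/
open scoped Classical

/-- The values of `z` excluded once `x, y` are fixed. -/
noncomputable def forb {R : Type*} [CommRing R] (x y : R) : Finset R :=
  {0, x, -x, y, -y, x + y, -(x + y), x - y, -(x - y)}

theorem card_five {R : Type*} [CommRing R] (h t : R) (hh : 2 * h = 1) (ht : 3 * t = 1)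
    (x : R) (hx : x ≠ 0) : ({0, x, -x, 2 * x, -(2 * x)} : Finset R).card = 5 := by
  have h2 : ∀ a : R, 2 * a = 0 → a = 0 := fun a ha => by linear_combination h * ha - a * hh
  have h3 : ∀ a : R, 3 * a = 0 → a = 0 := fun a ha => by linear_combination t * ha - a * ht
  have e2 : 2 * x ≠ 0 := fun e => hx (h2 _ e)
  have e3 : 3 * x ≠ 0 := fun e => hx (h3 _ e)
  have e4 : 4 * x ≠ 0 := fun e => e2 (h2 _ (by linear_combination e))
  repeat rw [Finset.card_insert_of_notMem]
  · simp
  all_goals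
    simp only [Finset.mem_insert, Finset.mem_singleton, not_or]
    (try refine ⟨?_, ?_, ?_, ?_⟩) <;> grind

theorem card_seven {R : Type*} [CommRing R] (h t : R) (hh : 2 * h = 1) (ht : 3 * t = 1)
    (x : R) (hx : x ≠ 0) (h5 : 5 * x ≠ 0) :
    ({0, x, -x, 2 * x, -(2 * x), 3 * x, -(3 * x)} : Finset R).card = 7 := by
  have h2 : ∀ a : R, 2 * a = 0 → a = 0 := fun a ha => by linear_combination h * ha - a * hh
  have h3 : ∀ a : R, 3 * a = 0 → a = 0 := fun a ha => by linear_combination t * ha - a * ht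
  have e2 : 2 * x ≠ 0 := fun e => hx (h2 _ e)
  have e3 : 3 * x ≠ 0 := fun e => hx (h3 _ e)
  have e4 : 4 * x ≠ 0 := fun e => e2 (h2 _ (by linear_combination e))
  have e6 : 6 * x ≠ 0 := fun e => e3 (h2 _ (by linear_combination e))
  repeat rw [Finset.card_insert_of_notMem]
  · simp
  all_goals
    simp only [Finset.mem_insert, Finset.mem_singleton, not_or]
    grind

theorem card_nine {R : Type*} [CommRing R] (h : R) (hh : 2 * h = 1)
    (x y : R) (hx : x ≠ 0) (hy : y ≠ 0) (hxy : y ≠ x) (hxy' : y ≠ -x)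
    (a1 : y ≠ 2 * x) (a2 : y ≠ -(2 * x)) (a3 : x ≠ 2 * y) (a4 : x ≠ -(2 * y)) :
    (forb x y).card = 9 := by
  have h2 : ∀ a : R, 2 * a = 0 → a = 0 := fun a ha => by linear_combination h * ha - a * hh
  have e1 : 2 * x ≠ 0 := fun e => hx (h2 _ e)
  have e2 : 2 * y ≠ 0 := fun e => hy (h2 _ e)
  have e3 : 2 * (x + y) ≠ 0 := fun e => hxy' (by linear_combination h2 _ e)
  have e4 : 2 * (x - y) ≠ 0 := fun e => hxy (by linear_combination - h2 _ e)
  unfold forb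
  repeat rw [Finset.card_insert_of_notMem]
  · simp
  all_goals
    simp only [Finset.mem_insert, Finset.mem_singleton, not_or]
    grind

theorem card_forb {R : Type*} [CommRing R] (h t : R) (hh : 2 * h = 1) (ht : 3 * t = 1)
    (x y : R) (hx : x ≠ 0) (hy : y ≠ 0) (hxy : y ≠ x) (hxy' : y ≠ -x) :
    ((forb x y).card : ℤ) = 9 - 2 * ((if y = 2 * x then 1 else 0)
      + (if y = -(2 * x) then 1 else 0) + (if y = h * x then 1 else 0)
      + (if y = -(h * x) then 1 else 0)) := by
  have h2 : ∀ a : R, 2 * a = 0 → a = 0 := fun a ha => by linear_combination h * ha - a * hh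
  have h3 : ∀ a : R, 3 * a = 0 → a = 0 := fun a ha => by linear_combination t * ha - a * ht
  have e2 : 2 * x ≠ 0 := fun e => hx (h2 _ e)
  have e3 : 3 * x ≠ 0 := fun e => hx (h3 _ e)
  have e4 : 4 * x ≠ 0 := fun e => e2 (h2 _ (by linear_combination e))
  have i3 : y = h * x ↔ x = 2 * y :=
    ⟨fun e => by linear_combination (-2) * e - x * hh,
     fun e => by linear_combination (-h) * e - y * hh⟩
  have i4 : y = -(h * x) ↔ x = -(2 * y) :=
    ⟨fun e => by linear_combination 2 * e - x * hh,
     fun e => by linear_combination h * e - y * hh⟩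
  rw [i3, i4]
  by_cases a1 : y = 2 * x
  · have n2 : y ≠ -(2 * x) := fun e => e4 (by linear_combination e - a1)
    have n3 : x ≠ 2 * y := fun e => e3 (by linear_combination -e - 2 * a1)
    by_cases a4 : x = -(2 * y)
    · have : forb x y = {0, x, -x, 2 * x, -(2 * x)} := by
        ext z; simp only [forb, Finset.mem_insert, Finset.mem_singleton]; grind
      rw [this, card_five h t hh ht x hx, if_pos a1, if_neg n2, if_neg n3, if_pos a4]; norm_num
    · have : forb x y = {0, x, -x, 2 * x, -(2 * x), 3 * x, -(3 * x)} := by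
        ext z; simp only [forb, Finset.mem_insert, Finset.mem_singleton]; grind
      rw [this, card_seven h t hh ht x hx (fun e => a4 (by linear_combination e + 2 * a1)),
        if_pos a1, if_neg n2, if_neg n3, if_neg a4]; norm_num
  by_cases a2 : y = -(2 * x)
  · have n4 : x ≠ -(2 * y) := fun e => e3 (by linear_combination -e + 2 * a2)
    by_cases a3 : x = 2 * y
    · have : forb x y = {0, x, -x, 2 * x, -(2 * x)} := by
        ext z; simp only [forb, Finset.mem_insert, Finset.mem_singleton]; grind
      rw [this, card_five h t hh ht x hx, if_neg a1, if_pos a2, if_pos a3, if_neg n4]; norm_num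
    · have : forb x y = {0, x, -x, 2 * x, -(2 * x), 3 * x, -(3 * x)} := by
        ext z; simp only [forb, Finset.mem_insert, Finset.mem_singleton]; grind
      rw [this, card_seven h t hh ht x hx (fun e => a3 (by linear_combination e - 2 * a2)),
        if_neg a1, if_pos a2, if_neg a3, if_neg n4]; norm_num
  by_cases a3 : x = 2 * y
  · have n4 : x ≠ -(2 * y) := fun e => e2 (by linear_combination e + a3)
    have : forb x y = {0, y, -y, 2 * y, -(2 * y), 3 * y, -(3 * y)} := by
      ext z; simp only [forb, Finset.mem_insert, Finset.mem_singleton]; grind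
    rw [this, card_seven h t hh ht y hy (fun e => a2 (by linear_combination e + 2 * a3)),
      if_neg a1, if_neg a2, if_pos a3, if_neg n4]; norm_num
  by_cases a4 : x = -(2 * y)
  · have : forb x y = {0, y, -y, 2 * y, -(2 * y), 3 * y, -(3 * y)} := by
      ext z; simp only [forb, Finset.mem_insert, Finset.mem_singleton]; grind
    rw [this, card_seven h t hh ht y hy (fun e => a1 (by linear_combination e - 2 * a4)),
      if_neg a1, if_neg a2, if_neg a3, if_pos a4]; norm_num
  rw [card_nine h hh x y hx hy hxy hxy' a1 a2 a3 a4, if_neg a1, if_neg a2, if_neg a3, if_neg a4]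
  norm_num

theorem qmu_zero_iff (n : ℕ) (x y z : ZMod n) :
    qmu n (x, y, z) = 0 ↔
      x ≠ 0 ∧ y ∉ ({0, x, -x} : Finset (ZMod n)) ∧ z ∉ forb x y := by
  unfold qmu
  rw [Finset.card_eq_zero, Finset.filter_eq_empty_iff]
  simp only [queenU, qdot, forb, Finset.mem_insert, Finset.mem_singleton, forall_eq_or_imp,
    forall_eq]
  constructor
  · rintro ⟨h1, h2, h3, h4, h5, h6, h7, h8, h9, h10, h11, h12, h13⟩
    refine ⟨by simpa using h1, ?_, ?_⟩
    · rintro (e | e | e) <;> subst e <;> simp at *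
    · rintro (e | e | e | e | e | e | e | e | e) <;> subst e
      · apply h3; ring
      · apply h7; ring
      · apply h6; ring
      · apply h9; ring
      · apply h8; ring
      · apply h11; ring
      · apply h10; ring
      · apply h13; ring
      · apply h12; ring
  · rintro ⟨h1, h2, h3⟩
    push Not at h2 h3
    refine ⟨?_, ?_, ?_, ?_, ?_, ?_, ?_, ?_, ?_, ?_, ?_, ?_, ?_⟩ <;> grind

theorem queen_inner_sum {R : Type*} [CommRing R] [Fintype R] (h t : R) (hh : 2 * h = 1)
    (ht : 3 * t = 1) (x : R) (hx : x ≠ 0) :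
    ∑ y ∈ ({0, x, -x} : Finset R)ᶜ, (((forb x y)ᶜ.card : ℕ) : ℤ)
      = ((Fintype.card R : ℤ) - 3) * (Fintype.card R - 9) + 8 := by
  have h2 : ∀ a : R, 2 * a = 0 → a = 0 := fun a ha => by linear_combination h * ha - a * hh
  have h3 : ∀ a : R, 3 * a = 0 → a = 0 := fun a ha => by linear_combination t * ha - a * ht
  have e2 : 2 * x ≠ 0 := fun e => hx (h2 _ e)
  have e3 : 3 * x ≠ 0 := fun e => hx (h3 _ e)
  have c3 : ((({0, x, -x} : Finset R)ᶜ.card : ℕ) : ℤ) = (Fintype.card R : ℤ) - 3 := by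
    have : ({0, x, -x} : Finset R).card = 3 := by
      rw [Finset.card_eq_three]
      refine ⟨0, x, -x, hx.symm, ?_, ?_, rfl⟩ <;> grind
    rw [Finset.card_compl, Nat.cast_sub (Finset.card_le_univ _), this]; norm_num
  have hm : ∀ c, c = 2 * x ∨ c = -(2 * x) ∨ c = h * x ∨ c = -(h * x) →
      c ∈ ({0, x, -x} : Finset R)ᶜ := by
    have k : 2 * (h * x) = x := by linear_combination x * hh
    intro c hc
    simp only [Finset.mem_compl, Finset.mem_insert, Finset.mem_singleton, not_or]
    rcases hc with rfl | rfl | rfl | rfl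
    · refine ⟨e2, fun e => hx (by linear_combination e), fun e => e3 (by linear_combination e)⟩
    · refine ⟨fun e => e2 (by linear_combination -e), fun e => e3 (by linear_combination -e),
        fun e => hx (by linear_combination -e)⟩
    · refine ⟨fun e => hx (by linear_combination 2 * e - k),
        fun e => hx (by linear_combination k - 2 * e),
        fun e => e3 (by linear_combination 2 * e - k)⟩
    · refine ⟨fun e => hx (by linear_combination -2 * e - k),
        fun e => e3 (by linear_combination -2 * e - k),
        fun e => hx (by linear_combination k + 2 * e)⟩
  have step : ∀ y ∈ ({0, x, -x} : Finset R)ᶜ, (((forb x y)ᶜ.card : ℕ) : ℤ)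
      = ((Fintype.card R : ℤ) - 9) + 2 * ((if y = 2 * x then 1 else 0)
      + (if y = -(2 * x) then 1 else 0) + (if y = h * x then 1 else 0)
      + (if y = -(h * x) then 1 else 0)) := by
    intro y hy
    simp only [Finset.mem_compl, Finset.mem_insert, Finset.mem_singleton, not_or] at hy
    rw [Finset.card_compl, Nat.cast_sub (Finset.card_le_univ _),
      card_forb h t hh ht x y hx hy.1 hy.2.1 hy.2.2]
    ring
  rw [Finset.sum_congr rfl step, Finset.sum_add_distrib, Finset.sum_const, nsmul_eq_mul, c3,
    ← Finset.mul_sum, Finset.sum_add_distrib, Finset.sum_add_distrib, Finset.sum_add_distrib]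
  simp only [Finset.sum_ite_eq']
  rw [if_pos (hm _ (by simp)), if_pos (hm _ (by simp)), if_pos (hm _ (by simp)),
    if_pos (hm _ (by simp))]
  norm_num

/-- Multiplicity count: the number of frequencies with `μ(a) = 0` is exactly
`n³ − 13n² + 47n − 35` (stated in `ℤ` to avoid truncated subtraction). -/
theorem stmt17 (n : ℕ) (hn : 5 ≤ n) (hodd : Odd n) (h3 : ¬ (3 ∣ n)) :
    ({a : Z3 n | qmu n a = 0}.ncard : ℤ)
      = (n : ℤ) ^ 3 - 13 * (n : ℤ) ^ 2 + 47 * (n : ℤ) - 35 := by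
  have : NeZero n := ⟨by omega⟩
  have hh : (2 : ZMod n) * (2 : ZMod n)⁻¹ = 1 := by
    have := ZMod.coe_mul_inv_eq_one (n := n) 2 (Nat.coprime_two_left.mpr hodd)
    exact_mod_cast this
  have ht : (3 : ZMod n) * (3 : ZMod n)⁻¹ = 1 := by
    have := ZMod.coe_mul_inv_eq_one (n := n) 3 ((Nat.Prime.coprime_iff_not_dvd Nat.prime_three).2 h3)
    exact_mod_cast this
  have hset : {a : Z3 n | qmu n a = 0} = ((({0} : Finset (ZMod n))ᶜ.sigma
      (fun x => ({0, x, -x} : Finset (ZMod n))ᶜ.sigma (fun y => (forb x y)ᶜ))).image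
        (fun p => ((p.1, p.2.1, p.2.2) : Z3 n)) : Finset (Z3 n)) := by
    ext ⟨x, y, z⟩
    rw [Set.mem_ofPred_eq, qmu_zero_iff, Finset.mem_coe, Finset.mem_image]
    constructor
    · rintro ⟨h1, h2, h3⟩
      refine ⟨⟨x, y, z⟩, ?_, rfl⟩
      simp only [Finset.mem_sigma, Finset.mem_compl]
      exact ⟨by simpa using h1, h2, h3⟩
    · rintro ⟨⟨x', y', z'⟩, hm, e⟩
      simp only [Prod.mk.injEq] at e
      obtain ⟨rfl, rfl, rfl⟩ := e
      simp only [Finset.mem_sigma, Finset.mem_compl] at hm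
      exact ⟨by simpa using hm.1, hm.2.1, hm.2.2⟩
  rw [hset, Set.ncard_coe_finset, Finset.card_image_of_injective, Finset.card_sigma]
  · simp only [Finset.card_sigma]
    push_cast
    have key : ∀ x ∈ ({0} : Finset (ZMod n))ᶜ,
        ∑ y ∈ ({0, x, -x} : Finset (ZMod n))ᶜ, (((forb x y)ᶜ.card : ℕ) : ℤ)
          = ((Fintype.card (ZMod n) : ℤ) - 3) * (Fintype.card (ZMod n) - 9) + 8 := by
      intro x hx
      convert queen_inner_sum _ _ hh ht x (by simpa using hx)
    rw [Finset.sum_congr rfl key, Finset.sum_const, nsmul_eq_mul, Finset.card_compl, ZMod.card, Finset.card_singleton,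
      Nat.cast_sub (by omega)]
    push_cast
    ring
  · rintro ⟨x, y, z⟩ ⟨x', y', z'⟩ e
    simp only [Prod.mk.injEq] at e
    obtain ⟨rfl, rfl, rfl⟩ := e
    rfl
end

section
/- Let n ≥ 5 be odd with 3 ∤ n, and let c ∈ ZMod n with c ≠ 0. Then μ((c,c,c)) = 3 (space-diagonal line) and μ((c,−2c,c)) = 2 (skew line). -/
open scoped Classical

/-- Space-diagonal and skew lines: for `c ≠ 0`, `μ((c,c,c)) = 3` and
`μ((c,−2c,c)) = 2`. -/
theorem stmt19 (n : ℕ) (hn : 5 ≤ n) (hodd : Odd n) (h3 : ¬ (3 ∣ n))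
    (c : ZMod n) (hc : c ≠ 0) :
    qmu n (c, c, c) = 3 ∧ qmu n (c, -2 * c, c) = 2 := by
  have key : ∀ k : ℕ, Nat.Coprime k n → (k : ZMod n) * c ≠ 0 := by
    intro k hk h
    have hu : IsUnit (k : ZMod n) := (ZMod.isUnit_iff_coprime k n).2 hk
    exact hc ((hu.mul_right_eq_zero).1 h)
  have c2 : Nat.Coprime 2 n := Nat.coprime_two_left.2 hodd
  have c3 : Nat.Coprime 3 n := (Nat.Prime.coprime_iff_not_dvd Nat.prime_three).2 h3
  have h2 : 2 * c ≠ 0 := by simpa using key 2 c2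
  have h3c : 3 * c ≠ 0 := by simpa using key 3 c3
  have h4 : 4 * c ≠ 0 := by simpa using key 4 (Nat.Coprime.mul_left c2 c2)
  have h10 : (1 : ZMod n) ≠ 0 := fun h => hc (by linear_combination c * h)
  have h11 : (1 : ZMod n) ≠ -1 := fun h => h2 (by linear_combination c * h)
  have e1 : (queenU n).filter (fun u => qdot (c, c, c) u = 0)
      = {(1, -1, 0), (1, 0, -1), (0, 1, -1)} := by
    ext u
    simp only [queenU, Finset.mem_filter, Finset.mem_insert, Finset.mem_singleton]
    constructor
    · rintro ⟨h, hu⟩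
      rcases h with h | h | h | h | h | h | h | h | h | h | h | h | h <;> subst h <;>
        simp only [qdot] at hu <;> first | (simp; done) | (exfalso; grind)
    · rintro (h | h | h) <;> subst h <;> simp [qdot]
  have e2 : (queenU n).filter (fun u => qdot (c, -2 * c, c) u = 0)
      = {(1, 0, -1), (1, 1, 1)} := by
    ext u
    simp only [queenU, Finset.mem_filter, Finset.mem_insert, Finset.mem_singleton]
    constructor
    · rintro ⟨h, hu⟩
      rcases h with h | h | h | h | h | h | h | h | h | h | h | h | h <;> subst h <;>
        simp only [qdot] at hu <;> first | (simp; done) | (exfalso; grind)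
    · rintro (h | h) <;> subst h <;> simp [qdot]
      ring
  constructor
  · rw [qmu, e1, Finset.card_eq_three]
    refine ⟨_, _, _, ?_, ?_, ?_, rfl⟩ <;> simp [h10]
  · rw [qmu, e2, Finset.card_pair]
    simp [h10.symm]
end
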